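/- arXiv:1109.6470 — 2 statements merged into one kernel-verified Lean document; each statement's English description precedes it below -/
import Mathlib

section
/- For every integer m ≥ 3, H(m−1, m) ≥ (m+2)·ln(m+2)/(3 ln 2) − ((m+2)/3)·(1 + ln 3/ln 2) + 1. -/
open Filter Polynomial

/-- `Γ` is a periodic orbit of the planar vector field `V`: the image of a
nonconstant periodic solution of `γ' = V ∘ γ`. -/
def IsPeriodicOrbit (V : ℝ × ℝ → ℝ × ℝ) (Γ : Set (ℝ × ℝ)) : Prop :=
  ∃ γ : ℝ → ℝ × ℝ,
    (∀ t : ℝ, HasDerivAt γ (V (γ t)) t) ∧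
    (∃ T : ℝ, 0 < T ∧ Function.Periodic γ T) ∧
    (∃ t₁ t₂ : ℝ, γ t₁ ≠ γ t₂) ∧
    Γ = Set.range γ

/-- `Γ` is a limit cycle of `V`: a periodic orbit which is isolated among
periodic orbits. -/
def IsLimitCycle (V : ℝ × ℝ → ℝ × ℝ) (Γ : Set (ℝ × ℝ)) : Prop :=
  IsPeriodicOrbit V Γ ∧
  ∃ U : Set (ℝ × ℝ), IsOpen U ∧ Γ ⊆ U ∧
    ∀ Γ' : Set (ℝ × ℝ), IsPeriodicOrbit V Γ' → Γ' ⊆ U → Γ' = Γ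

/-- The Liénard vector field `ẋ = y, ẏ = -g(x) - ε f(x) y`. -/
def lienard (f g : Polynomial ℝ) (ε : ℝ) : ℝ × ℝ → ℝ × ℝ :=
  fun p => (p.2, -(g.eval p.1) - ε * (f.eval p.1) * p.2)

/-- `HGe n m c` formalizes `H(n,m) ≥ c`: there are polynomials `f, g` with
`deg f ≤ n`, `deg g ≤ m` and `ε₀ > 0` such that for every `0 < ε ≤ ε₀` the
Liénard system has at least `c` pairwise distinct limit cycles. -/
def HGe (n m : ℕ) (c : ℝ) : Prop :=
  ∃ f g : Polynomial ℝ, f.natDegree ≤ n ∧ g.natDegree ≤ m ∧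
    ∃ ε₀ : ℝ, 0 < ε₀ ∧ ∀ ε : ℝ, 0 < ε → ε ≤ ε₀ →
      ∃ S : Finset (Set (ℝ × ℝ)),
        (∀ Γ ∈ S, IsLimitCycle (lienard f g ε) Γ) ∧ c ≤ (S.card : ℝ)

section ScalarODE
open Set Topology

/-- A solution on one period whose end values agree extends to a periodic solution. -/
lemma exists_periodic_extension {f : ℝ → ℝ} {w : ℝ → ℝ → ℝ} {P : ℝ} (hP : 0 < P)
    (hf : ∀ t ∈ Icc 0 P, HasDerivWithinAt f (w t (f t)) (Icc 0 P) t) (h0 : f 0 = f P)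
    (hw : ∀ t r, w (t + P) r = w t r) :
    ∃ u : ℝ → ℝ, Function.Periodic u P ∧ (∀ t ∈ Ico 0 P, u t = f t) ∧
      ∀ t, HasDerivAt u (w t (u t)) t := by
  set u : ℝ → ℝ := fun t => f (toIcoMod hP 0 t) with hu
  have hper : Function.Periodic u P := fun t => by simp [hu]
  have heq : ∀ t ∈ Ico 0 P, u t = f t := fun t ht => by
    simp only [hu]; rw [(toIcoMod_eq_self hP).2 (by simpa using ht)]
  have hwn : ∀ (n : ℤ) t r, w (t - n * P) r = w t r := fun n t r => by
    have : Function.Periodic (fun t => w t r) P := fun t => hw t r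
    exact this.sub_int_mul_eq n
  have hbase : ∀ t ∈ Ico 0 P, HasDerivAt u (w t (u t)) t := by
    intro t ht
    rcases eq_or_lt_of_le ht.1 with h | h
    · subst h
      have h1 : HasDerivWithinAt u (w 0 (u 0)) (Ici 0) 0 := by
        have := hf 0 ⟨le_rfl, hP.le⟩
        have h2 : HasDerivWithinAt f (w 0 (f 0)) (Ici 0) 0 :=
          this.mono_of_mem_nhdsWithin (Icc_mem_nhdsGE hP)
        rw [heq 0 ht]
        refine h2.congr_of_eventuallyEq ?_ (heq 0 ht)
        filter_upwards [Ico_mem_nhdsGE hP] with s hs using heq s hs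
      have h3 : HasDerivWithinAt u (w 0 (u 0)) (Iic 0) 0 := by
        have := hf P ⟨hP.le, le_rfl⟩
        have h2 : HasDerivWithinAt f (w P (f P)) (Iic P) P :=
          this.mono_of_mem_nhdsWithin (Icc_mem_nhdsLE hP)
        have h4 : HasDerivWithinAt (fun s => f (s + P)) (w P (f P)) (Iic 0) 0 := by
          have := HasDerivWithinAt.scomp (g₁ := f) (h := fun s : ℝ => s + P) (t' := Iic P)
            (s := Iic 0) (h' := (1:ℝ)) (0:ℝ) (by simpa using h2)
            ((hasDerivAt_id (0:ℝ)).add_const P).hasDerivWithinAt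
            (fun s hs => by simpa using hs)
          simpa [Function.comp_def] using this
        have h5 : w P (f P) = w 0 (u 0) := by
          rw [heq 0 ht, h0, ← hw 0, zero_add]
        rw [h5] at h4
        refine h4.congr_of_eventuallyEq ?_ (by simp [heq 0 ht, h0])
        have : Ioc (-P) 0 ∈ 𝓝[≤] (0:ℝ) := Ioc_mem_nhdsLE (by linarith)
        filter_upwards [this] with s hs
        rcases eq_or_lt_of_le hs.2 with h | h
        · subst h; simp [heq 0 ht, h0]
        · rw [← hper s]; exact heq _ ⟨by linarith [hs.1], by linarith⟩
      have := h3.union h1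
      rwa [Iic_union_Ici, hasDerivWithinAt_univ] at this
    · have h1 := (hf t ⟨ht.1, ht.2.le⟩).hasDerivAt (Icc_mem_nhds h ht.2)
      rw [heq t ht]
      refine h1.congr_of_eventuallyEq ?_
      filter_upwards [Ioo_mem_nhds h ht.2] with s hs using heq s ⟨hs.1.le, hs.2⟩
  refine ⟨u, hper, heq, fun t => ?_⟩
  set n := toIcoDiv hP 0 t
  have hm : t - n * P ∈ Ico 0 P := by
    have := sub_toIcoDiv_zsmul_mem_Ico hP 0 t
    rwa [zero_add, zsmul_eq_mul] at this
  have h1 := hbase _ hm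
  rw [hwn, hper.sub_int_mul_eq] at h1
  have h2 := HasDerivAt.comp_sub_const t (n * P) h1
  refine h2.congr_of_eventuallyEq (Eventually.of_forall fun s => ?_)
  exact (hper.sub_int_mul_eq n).symm

/-- Existence of a periodic solution of a slowly varying scalar equation by averaging. -/
theorem exists_periodic_solution {v : ℝ → ℝ → ℝ} {S R₀ : ℝ → ℝ} {r₀ η ε κ δ C B μ : ℝ}
    (hη : 0 < η) (hε : 0 < ε) (hκ : 0 ≤ κ)
    (hv : ContinuousOn (Function.uncurry v) (univ ×ˢ Icc (r₀ - η) (r₀ + η)))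
    (hvp : ∀ θ r, v (θ + 2 * Real.pi) r = v θ r)
    (hlip : ∀ θ, ∀ r ∈ Icc (r₀ - η) (r₀ + η), ∀ r' ∈ Icc (r₀ - η) (r₀ + η),
      |v θ r - v θ r' - S θ * (r - r')| ≤ κ * |r - r'|)
    (hR : ∀ θ, |v θ r₀ - R₀ θ| ≤ δ)
    (hC : ∀ θ, ∀ r ∈ Icc (r₀ - η) (r₀ + η), |v θ r| ≤ C)
    (hS : Continuous S) (hR₀ : Continuous R₀) (hB : ∀ θ, |S θ| ≤ B)
    (h0 : ∫ θ in (0)..(2 * Real.pi), R₀ θ = 0) (hμ : ∫ θ in (0)..(2 * Real.pi), S θ = μ)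
    (h1 : 2 * Real.pi * (ε * C) ≤ η / 4)
    (h2 : 2 * Real.pi * (κ * η + δ + B * (2 * Real.pi * (ε * C))) < |μ| * (η / 2)) :
    ∃ u : ℝ → ℝ, Function.Periodic u (2 * Real.pi) ∧ (∀ θ, |u θ - r₀| < η) ∧
      ∀ θ, HasDerivAt u (ε * v θ (u θ)) θ := by
  have hπ := Real.pi_pos
  set P := 2 * Real.pi with hPdef
  have hP : 0 < P := by positivity
  have hC0 : 0 ≤ C := (abs_nonneg _).trans (hC 0 r₀ ⟨by linarith, by linarith⟩)
  have hB0 : 0 ≤ B := (abs_nonneg _).trans (hB 0)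
  set c : ℝ → ℝ := fun r => max (r₀ - η) (min r (r₀ + η)) with hc
  have hcI : ∀ r, c r ∈ Icc (r₀ - η) (r₀ + η) := fun r =>
    ⟨le_max_left _ _, max_le (by linarith) (min_le_right _ _)⟩
  have hcid : ∀ r ∈ Icc (r₀ - η) (r₀ + η), c r = r := fun r hr => by
    simp only [hc]; rw [min_eq_left hr.2, max_eq_right hr.1]
  have hclip : ∀ r r', |c r - c r'| ≤ |r - r'| := fun r r' => by
    simp only [hc]
    refine (abs_max_sub_max_le_max _ _ _ _).trans ?_
    simp only [sub_self, abs_zero]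
    refine max_le (abs_nonneg _) ((abs_min_sub_min_le_max _ _ _ _).trans ?_)
    simp
  have hccont : Continuous c := by fun_prop
  set V : ℝ → ℝ → ℝ := fun θ r => ε * v θ (c r) with hV
  have hvl : ∀ θ, ∀ r ∈ Icc (r₀ - η) (r₀ + η), ∀ r' ∈ Icc (r₀ - η) (r₀ + η),
      |v θ r - v θ r'| ≤ (κ + B) * |r - r'| := fun θ r hr r' hr' => by
    have h3 := hlip θ r hr r' hr'
    calc |v θ r - v θ r'| = |(v θ r - v θ r' - S θ * (r - r')) + S θ * (r - r')| := by ring_nf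
      _ ≤ |v θ r - v θ r' - S θ * (r - r')| + |S θ| * |r - r'| := by
        rw [← abs_mul]; exact abs_add_le _ _
      _ ≤ _ := by
        have := mul_le_mul_of_nonneg_right (hB θ) (abs_nonneg (r - r'))
        linarith
  have hvc : ∀ g : ℝ → ℝ, ∀ s : Set ℝ, ContinuousOn g s →
      ContinuousOn (fun θ => v θ (c (g θ))) s := by
    intro g s hg
    exact hv.comp (f := fun θ => (θ, c (g θ))) (s := s)
      (continuousOn_id.prodMk (hccont.comp_continuousOn hg)) (fun θ _ => ⟨mem_univ _, hcI _⟩)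
  have hPL : IsPicardLindelof V (tmin := 0) (tmax := P) ⟨0, le_rfl, hP.le⟩ r₀
      η.toNNReal (η / 2).toNNReal (ε * C).toNNReal (ε * (κ + B)).toNNReal := by
    have e1 := Real.coe_toNNReal η hη.le
    have e2 := Real.coe_toNNReal (η / 2) (by positivity)
    have e3 := Real.coe_toNNReal (ε * C) (by positivity)
    have e4 := Real.coe_toNNReal (ε * (κ + B)) (by positivity)
    constructor
    · intro t _
      refine LipschitzOnWith.of_dist_le_mul fun x _ y _ => ?_
      simp only [Real.dist_eq, hV, e4]
      rw [← mul_sub, abs_mul, abs_of_pos hε, mul_assoc]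
      have := hvl t _ (hcI x) _ (hcI y)
      have h3 := mul_le_mul_of_nonneg_left (hclip x y) (by positivity : 0 ≤ κ + B)
      gcongr
      linarith
    · intro x _
      exact continuousOn_const.mul (hvc (fun _ => x) _ continuousOn_const)
    · intro t _ x _
      simp only [Real.norm_eq_abs, hV, e3]
      rw [abs_mul, abs_of_pos hε]
      gcongr
      exact hC _ _ (hcI x)
    · simp only [e1, e2, e3, sub_zero, sub_self]
      rw [max_eq_left hP.le]
      linarith
  obtain ⟨α, hα, L', hL'⟩ := hPL.exists_forall_mem_closedBall_eq_hasDerivWithinAt_lipschitzOnWith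
  have hball : Metric.closedBall r₀ (η / 2) = Icc (r₀ - η / 2) (r₀ + η / 2) :=
    Real.closedBall_eq_Icc
  rw [Real.coe_toNNReal (η / 2) (by positivity), hball] at hα hL'
  have hcontα : ∀ x ∈ Icc (r₀ - η / 2) (r₀ + η / 2), ContinuousOn (α x) (Icc 0 P) :=
    fun x hx t ht => ((hα x hx).2 t ht).continuousWithinAt
  -- closeness to the initial value
  have hclose : ∀ x ∈ Icc (r₀ - η / 2) (r₀ + η / 2), ∀ t ∈ Icc 0 P, |α x t - x| ≤ P * (ε * C) := by
    intro x hx t ht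
    have h3 := (convex_Icc (0:ℝ) P).norm_image_sub_le_of_norm_hasDerivWithin_le (C := ε * C)
      (fun t ht => (hα x hx).2 t ht) (fun t _ => by
        simp only [Real.norm_eq_abs, hV]
        rw [abs_mul, abs_of_pos hε]
        gcongr
        exact hC _ _ (hcI _)) (left_mem_Icc.2 hP.le) ht
    have h4 : α x 0 = x := (hα x hx).1
    rw [h4, Real.norm_eq_abs, Real.norm_eq_abs, sub_zero, abs_of_nonneg ht.1] at h3
    refine h3.trans ?_
    rw [mul_comm]
    gcongr
    exact ht.2
  have hmem : ∀ x ∈ Icc (r₀ - η / 2) (r₀ + η / 2), ∀ t ∈ Icc 0 P, |α x t - r₀| < η := by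
    intro x hx t ht
    have h3 := hclose x hx t ht
    have h4 : |x - r₀| ≤ η / 2 := by rw [abs_le]; constructor <;> linarith [hx.1, hx.2]
    have h5 : |α x t - r₀| ≤ |α x t - x| + |x - r₀| := abs_sub_le _ _ _
    linarith
  have hmemI : ∀ x ∈ Icc (r₀ - η / 2) (r₀ + η / 2), ∀ t ∈ Icc 0 P,
      α x t ∈ Icc (r₀ - η) (r₀ + η) := by
    intro x hx t ht
    have := abs_lt.1 (hmem x hx t ht)
    exact ⟨by linarith, by linarith⟩
  -- the displacement
  have hdisp : ∀ x ∈ Icc (r₀ - η / 2) (r₀ + η / 2),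
      α x P - x = ε * ∫ θ in (0)..P, v θ (c (α x θ)) := by
    intro x hx
    have h3 := intervalIntegral.integral_eq_sub_of_hasDeriv_right (a := 0) (b := P)
      (f := α x) (f' := fun t => V t (α x t)) (by rw [uIcc_of_le hP.le]; exact hcontα x hx)
      (fun t ht => by
        rw [min_eq_left hP.le, max_eq_right hP.le] at ht
        exact (((hα x hx).2 t ⟨ht.1.le, ht.2.le⟩).hasDerivAt
          (Icc_mem_nhds ht.1 ht.2)).hasDerivWithinAt)
      (ContinuousOn.intervalIntegrable (by
        rw [uIcc_of_le hP.le]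
        exact continuousOn_const.mul (hvc _ _ (hcontα x hx))))
    have h4 : α x 0 = x := (hα x hx).1
    rw [h4] at h3
    rw [← h3, ← intervalIntegral.integral_const_mul]
  have hest : ∀ x ∈ Icc (r₀ - η / 2) (r₀ + η / 2),
      |(∫ θ in (0)..P, v θ (c (α x θ))) - μ * (x - r₀)| < |μ| * (η / 2) := by
    intro x hx
    have hi1 : IntervalIntegrable (fun θ => v θ (c (α x θ))) MeasureTheory.volume 0 P :=
      ContinuousOn.intervalIntegrable (by
        rw [uIcc_of_le hP.le]; exact hvc _ _ (hcontα x hx))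
    have hi2 : IntervalIntegrable R₀ MeasureTheory.volume 0 P := hR₀.intervalIntegrable _ _
    have hi3 : IntervalIntegrable (fun θ => S θ * (x - r₀)) MeasureTheory.volume 0 P :=
      (hS.mul continuous_const).intervalIntegrable _ _
    have h3 : (∫ θ in (0)..P, v θ (c (α x θ))) - μ * (x - r₀) =
        ∫ θ in (0)..P, (v θ (c (α x θ)) - R₀ θ - S θ * (x - r₀)) := by
      rw [intervalIntegral.integral_sub (hi1.sub hi2) hi3, intervalIntegral.integral_sub hi1 hi2,
        h0, intervalIntegral.integral_mul_const, hμ, sub_zero]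
    rw [h3]
    have h4 := intervalIntegral.norm_integral_le_of_norm_le_const (a := 0) (b := P)
      (f := fun θ => v θ (c (α x θ)) - R₀ θ - S θ * (x - r₀))
      (C := κ * η + δ + B * (P * (ε * C))) (by
        intro θ hθ
        rw [uIoc_of_le hP.le] at hθ
        have hθ' : θ ∈ Icc 0 P := ⟨hθ.1.le, hθ.2⟩
        rw [hcid _ (hmemI x hx θ hθ'), Real.norm_eq_abs]
        have e1 := hlip θ _ (hmemI x hx θ hθ') r₀ ⟨by linarith, by linarith⟩
        have e2 := hR θ
        have e3 := hclose x hx θ hθ'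
        have e4 : κ * |α x θ - r₀| ≤ κ * η :=
          mul_le_mul_of_nonneg_left (hmem x hx θ hθ').le hκ
        have e5 : |S θ * (α x θ - x)| ≤ B * (P * (ε * C)) := by
          rw [abs_mul]; exact mul_le_mul (hB θ) e3 (abs_nonneg _) hB0
        calc |v θ (α x θ) - R₀ θ - S θ * (x - r₀)|
            = |(v θ (α x θ) - v θ r₀ - S θ * (α x θ - r₀)) + (v θ r₀ - R₀ θ)
                + S θ * (α x θ - x)| := by ring_nf
          _ ≤ |v θ (α x θ) - v θ r₀ - S θ * (α x θ - r₀)| + |v θ r₀ - R₀ θ|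
                + |S θ * (α x θ - x)| := abs_add_three _ _ _
          _ ≤ _ := by linarith)
    rw [Real.norm_eq_abs, sub_zero, abs_of_pos hP] at h4
    linarith
  -- intermediate value theorem
  have hcd : ContinuousOn (fun x => μ * (α x P - x)) (Icc (r₀ - η / 2) (r₀ + η / 2)) :=
    continuousOn_const.mul ((hL' P ⟨hP.le, le_rfl⟩).continuousOn.sub continuousOn_id)
  have hxl : r₀ - η / 2 ∈ Icc (r₀ - η / 2) (r₀ + η / 2) := ⟨le_rfl, by linarith⟩
  have hxr : r₀ + η / 2 ∈ Icc (r₀ - η / 2) (r₀ + η / 2) := ⟨by linarith, le_rfl⟩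
  have hμ0 : 0 < |μ| := by
    by_contra h
    have : |μ| = 0 := le_antisymm (not_lt.1 h) (abs_nonneg _)
    rw [this, zero_mul] at h2
    have hδ : 0 ≤ δ := (abs_nonneg _).trans (hR 0)
    have : 0 ≤ 2 * Real.pi * (κ * η + δ + B * (P * (ε * C))) := by positivity
    linarith
  have key : ∀ z I : ℝ, |I - μ * z| < |μ| * (η / 2) → |(μ * I) - μ ^ 2 * z| < μ ^ 2 * (η / 2) := by
    intro z I h
    have : μ * I - μ ^ 2 * z = μ * (I - μ * z) := by ring
    rw [this, abs_mul, ← sq_abs μ, pow_two, mul_assoc]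
    exact mul_lt_mul_of_pos_left h hμ0
  have hl : μ * (α (r₀ - η / 2) P - (r₀ - η / 2)) ≤ 0 := by
    have := (abs_lt.1 (key _ _ (hest _ hxl))).2
    rw [hdisp _ hxl]
    have h5 : μ * ∫ θ in (0)..P, v θ (c (α (r₀ - η / 2) θ)) ≤ 0 := by nlinarith
    nlinarith
  have hr : 0 ≤ μ * (α (r₀ + η / 2) P - (r₀ + η / 2)) := by
    have := (abs_lt.1 (key _ _ (hest _ hxr))).1
    rw [hdisp _ hxr]
    have h5 : 0 ≤ μ * ∫ θ in (0)..P, v θ (c (α (r₀ + η / 2) θ)) := by nlinarith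
    nlinarith
  obtain ⟨x, hx, hx0⟩ := intermediate_value_Icc (by linarith : r₀ - η / 2 ≤ r₀ + η / 2) hcd ⟨hl, hr⟩
  have hx1 : α x P = x := by
    rcases mul_eq_zero.1 hx0 with h | h
    · rw [h, abs_zero] at hμ0; exact absurd hμ0 (lt_irrefl _)
    · linarith
  obtain ⟨u, hu1, hu2, hu3⟩ := exists_periodic_extension (f := α x) (w := V) hP
    (fun t ht => (hα x hx).2 t ht) (by rw [hx1]; exact (hα x hx).1)
    (fun t r => by simp only [hV]; rw [hvp])
  have hub : ∀ θ, |u θ - r₀| < η := by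
    intro θ
    have hm : θ - toIcoDiv hP 0 θ * P ∈ Ico 0 P := by
      have := sub_toIcoDiv_zsmul_mem_Ico hP 0 θ
      rwa [zero_add, zsmul_eq_mul] at this
    rw [← hu1.sub_int_mul_eq (toIcoDiv hP 0 θ), hu2 _ hm]
    exact hmem x hx _ ⟨hm.1, hm.2.le⟩
  refine ⟨u, hu1, hub, fun θ => ?_⟩
  have := hu3 θ
  simp only [hV] at this
  rwa [hcid] at this
  have := abs_lt.1 (hub θ)
  exact ⟨by linarith, by linarith⟩

/-- Uniqueness: any orbit of the equation, traversed along a periodic angle, that stays in the strip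
coincides with a given periodic solution. -/
theorem eq_periodic_solution {v : ℝ → ℝ → ℝ} {S u r Θ ω : ℝ → ℝ} {r₀ η ε κ μ T : ℝ}
    (hε : 0 < ε)
    (hlip : ∀ θ, ∀ r ∈ Icc (r₀ - η) (r₀ + η), ∀ r' ∈ Icc (r₀ - η) (r₀ + η),
      |v θ r - v θ r' - S θ * (r - r')| ≤ κ * |r - r'|)
    (hS : Continuous S) (hSp : Function.Periodic S (2 * Real.pi))
    (hμ : ∫ θ in (0)..(2 * Real.pi), S θ = μ) (hκμ : 2 * Real.pi * κ < |μ|)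
    (hup : Function.Periodic u (2 * Real.pi)) (hu : ∀ θ, |u θ - r₀| < η)
    (hud : ∀ θ, HasDerivAt u (ε * v θ (u θ)) θ)
    (hr : ∀ t, |r t - r₀| < η) (hω : ∀ t, 0 < ω t)
    (hΘ : ∀ t, HasDerivAt Θ (ω t) t)
    (hrd : ∀ t, HasDerivAt r (ω t * (ε * v (Θ t) (r t))) t)
    (hT : 0 < T) (hrp : Function.Periodic r T)
    (hΘp : ∀ t, ∃ k : ℤ, Θ (t + T) = Θ t + k * (2 * Real.pi)) (t : ℝ) :
    r t = u (Θ t) := by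
  have hπ := Real.pi_pos
  set m := μ / (2 * Real.pi) with hm
  set B : ℝ → ℝ := fun θ => ∫ s in (0)..θ, (S s - m) with hB
  have hBd : ∀ θ, HasDerivAt B (S θ - m) θ := fun θ =>
    intervalIntegral.integral_hasDerivAt_right
      ((hS.sub continuous_const).intervalIntegrable _ _)
      ((hS.sub continuous_const).stronglyMeasurableAtFilter _ _)
      (hS.sub continuous_const).continuousAt
  have hBp : Function.Periodic B (2 * Real.pi) := by
    intro θ
    have h1 : B (θ + 2 * Real.pi) = B θ + ∫ s in θ..(θ + 2 * Real.pi), (S s - m) :=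
      (intervalIntegral.integral_add_adjacent_intervals
        ((hS.sub continuous_const).intervalIntegrable _ _)
        ((hS.sub continuous_const).intervalIntegrable _ _)).symm
    have h2 : Function.Periodic (fun s => S s - m) (2 * Real.pi) := fun s => by simp [hSp s]
    rw [h1, h2.intervalIntegral_add_eq θ 0, zero_add, intervalIntegral.integral_sub
      (hS.intervalIntegrable _ _) (by simp), hμ]
    simp [hm]
  set D : ℝ → ℝ := fun t => r t - u (Θ t) with hD
  set E : ℝ → ℝ := fun t => μ * (D t ^ 2 * Real.exp (-(2 * ε) * B (Θ t))) with hE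
  have hDd : ∀ t, HasDerivAt D (ω t * (ε * (v (Θ t) (r t) - v (Θ t) (u (Θ t))))) t := fun t => by
    exact ((hrd t).sub ((hud (Θ t)).comp t (hΘ t))).congr_deriv (by ring)
  set E' : ℝ → ℝ := fun t => 2 * ω t * ε * Real.exp (-(2 * ε) * B (Θ t)) *
    (μ * (D t * (v (Θ t) (r t) - v (Θ t) (u (Θ t)) - S (Θ t) * D t)) + μ * m * D t ^ 2) with hE'
  have hEd : ∀ t, HasDerivAt E (E' t) t := fun t => by
    have h1 := (((hBd (Θ t)).comp t (hΘ t)).const_mul (-(2 * ε))).exp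
    have h2 := (((hDd t).pow 2).mul h1).const_mul μ
    refine h2.congr_deriv ?_
    simp only [hE', Function.comp_apply, Pi.pow_apply]
    push_cast
    ring
  have hmem : ∀ x : ℝ, |x - r₀| < η → x ∈ Icc (r₀ - η) (r₀ + η) := fun x hx => by
    have := abs_lt.1 hx
    exact ⟨by linarith, by linarith⟩
  have hlow : ∀ t, 2 * ω t * ε * Real.exp (-(2 * ε) * B (Θ t)) *
      ((μ * m - |μ| * κ) * D t ^ 2) ≤ E' t := fun t => by
    have h1 := hlip (Θ t) _ (hmem _ (hr t)) _ (hmem _ (hu (Θ t)))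
    have h3 : |μ * (D t * (v (Θ t) (r t) - v (Θ t) (u (Θ t)) - S (Θ t) * D t))| ≤
        |μ| * κ * D t ^ 2 := by
      rw [abs_mul, abs_mul, ← sq_abs (D t)]
      have : |μ| * (|D t| * |v (Θ t) (r t) - v (Θ t) (u (Θ t)) - S (Θ t) * D t|) ≤
          |μ| * (|D t| * (κ * |D t|)) := by gcongr
      linarith
    have h4 := (abs_le.1 h3).1
    have := hω t
    simp only [hE']
    gcongr
    linarith
  have hc : 0 < μ * m - |μ| * κ := by
    have hμ0 : 0 < |μ| := by
      by_contra h
      have h0 : |μ| = 0 := le_antisymm (not_lt.1 h) (abs_nonneg _)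
      have h1 := hlip 0 (r₀ + 0) (hmem _ (by simpa using (abs_nonneg _).trans_lt (hu 0)))
        (u 0) (hmem _ (hu 0))
      have hη : 0 < η := (abs_nonneg _).trans_lt (hu 0)
      have h2 := hlip 0 (r₀ + η) ⟨by linarith, le_rfl⟩ r₀ ⟨by linarith, by linarith⟩
      have h3 := (abs_nonneg _).trans h2
      have h4 : 0 < |r₀ + η - r₀| := by rw [add_sub_cancel_left]; positivity
      have : 0 ≤ κ := nonneg_of_mul_nonneg_left h3 h4
      nlinarith
    have h1 : μ * m = |μ| * (|μ| / (2 * Real.pi)) := by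
      rw [hm, ← mul_div_assoc, ← mul_div_assoc, abs_mul_abs_self]
    rw [h1, ← mul_sub]
    apply mul_pos hμ0
    rw [sub_pos, lt_div_iff₀ (by positivity)]
    linarith
  have hE'0 : ∀ t, 0 ≤ E' t := fun t => by
    refine le_trans ?_ (hlow t)
    have := hω t
    positivity
  have hmono : Monotone E := monotone_of_hasDerivAt_nonneg (fun t => hEd t) hE'0
  have hEp : Function.Periodic E T := fun t => by
    obtain ⟨k, hk⟩ := hΘp t
    simp only [hE, hD, hrp t, hk]
    rw [hup.int_mul k, hBp.int_mul k]
  have hconst : ∀ x ∈ Icc t (t + T), E x = E t := fun x hx =>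
    le_antisymm ((hmono hx.2).trans (hEp t).le) (hmono hx.1)
  have h5 : HasDerivWithinAt E 0 (Icc t (t + T)) t :=
    (hasDerivWithinAt_const t _ (E t)).congr hconst rfl
  have h6 : E' t = 0 :=
    (uniqueDiffOn_Icc (by linarith : t < t + T) t ⟨le_rfl, by linarith⟩).eq_deriv _
      (hEd t).hasDerivWithinAt h5
  have h7 := hlow t
  rw [h6] at h7
  have h8 : D t ^ 2 ≤ 0 := by
    by_contra h
    have := hω t
    have : 0 < D t ^ 2 := not_le.1 h
    have : 0 < 2 * ω t * ε * Real.exp (-(2 * ε) * B (Θ t)) * ((μ * m - |μ| * κ) * D t ^ 2) := by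
      positivity
    linarith
  have : D t = 0 := by nlinarith [sq_nonneg (D t)]
  simp only [hD] at this
  linarith

end ScalarODE

section Averaging
open Set Topology

lemma uniform_near_slice {f : ℝ → ℝ → ℝ → ℝ} {r₀ η₁ ε₁ : ℝ} (hη₁ : 0 < η₁) (hε₁ : 0 < ε₁)
    (hf : ContinuousOn (fun p : ℝ × ℝ × ℝ => f p.1 p.2.1 p.2.2)
      (Icc 0 ε₁ ×ˢ univ ×ˢ Icc (r₀ - η₁) (r₀ + η₁)))
    (hp : ∀ ε θ r, f ε (θ + 2 * Real.pi) r = f ε θ r) :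
    (∃ C, ∀ ε ∈ Icc 0 ε₁, ∀ θ, ∀ r ∈ Icc (r₀ - η₁) (r₀ + η₁), |f ε θ r| ≤ C) ∧
    ∀ κ > 0, ∃ d > 0, ∀ ε ∈ Icc 0 ε₁, ε < d → ∀ θ, ∀ r ∈ Icc (r₀ - η₁) (r₀ + η₁),
      |r - r₀| < d → |f ε θ r - f 0 θ r₀| < κ := by
  have hP : (0:ℝ) < 2 * Real.pi := by positivity
  have hred : ∀ θ : ℝ, ∃ θ' ∈ Icc 0 (2 * Real.pi), ∀ ε r, f ε θ r = f ε θ' r := fun θ => by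
    refine ⟨toIcoMod hP 0 θ, ?_, fun ε r => ?_⟩
    · have := toIcoMod_mem_Ico hP 0 θ
      rw [zero_add] at this
      exact ⟨this.1, this.2.le⟩
    · have h : Function.Periodic (fun θ => f ε θ r) (2 * Real.pi) := fun θ => hp ε θ r
      rw [toIcoMod, zsmul_eq_mul]
      exact (h.sub_int_mul_eq _).symm
  set K : Set (ℝ × ℝ × ℝ) := Icc 0 ε₁ ×ˢ Icc 0 (2 * Real.pi) ×ˢ Icc (r₀ - η₁) (r₀ + η₁) with hK
  have hKc : IsCompact K := isCompact_Icc.prod (isCompact_Icc.prod isCompact_Icc)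
  have hfK : ContinuousOn (fun p : ℝ × ℝ × ℝ => f p.1 p.2.1 p.2.2) K :=
    hf.mono (prod_mono le_rfl (prod_mono (subset_univ _) le_rfl))
  constructor
  · obtain ⟨C, hC⟩ := hKc.exists_bound_of_continuousOn hfK
    refine ⟨C, fun ε hε θ r hr => ?_⟩
    obtain ⟨θ', hθ', h⟩ := hred θ
    rw [h]
    exact hC (ε, θ', r) ⟨hε, hθ', hr⟩
  · intro κ hκ
    obtain ⟨d, hd, h⟩ := Metric.uniformContinuousOn_iff.1
      (hKc.uniformContinuousOn_of_continuous hfK) κ hκ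
    refine ⟨d, hd, fun ε hε hεd θ r hr hrd => ?_⟩
    obtain ⟨θ', hθ', h'⟩ := hred θ
    rw [h', h']
    refine h (ε, θ', r) ⟨hε, hθ', hr⟩ (0, θ', r₀)
      ⟨⟨le_rfl, hε₁.le⟩, hθ', ⟨by linarith, by linarith⟩⟩ ?_
    simp only [Prod.dist_eq, dist_self, Real.dist_eq, sub_zero]
    rw [abs_of_nonneg hε.1]
    exact max_lt hεd (max_lt hd hrd)

/-- First order averaging: a simple zero of the averaged equation yields, for every small parameter,
a periodic solution, unique among all orbits in a strip. -/
theorem averaging {R S : ℝ → ℝ → ℝ → ℝ} {r₀ η₁ ε₁ : ℝ} (hη₁ : 0 < η₁) (hε₁ : 0 < ε₁)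
    (hR : ContinuousOn (fun p : ℝ × ℝ × ℝ => R p.1 p.2.1 p.2.2)
      (Icc 0 ε₁ ×ˢ univ ×ˢ Icc (r₀ - η₁) (r₀ + η₁)))
    (hS : ContinuousOn (fun p : ℝ × ℝ × ℝ => S p.1 p.2.1 p.2.2)
      (Icc 0 ε₁ ×ˢ univ ×ˢ Icc (r₀ - η₁) (r₀ + η₁)))
    (hRS : ∀ ε ∈ Icc 0 ε₁, ∀ θ, ∀ r ∈ Icc (r₀ - η₁) (r₀ + η₁), HasDerivAt (R ε θ) (S ε θ r) r)
    (hRp : ∀ ε θ r, R ε (θ + 2 * Real.pi) r = R ε θ r)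
    (hSp : ∀ ε θ r, S ε (θ + 2 * Real.pi) r = S ε θ r)
    (h0 : ∫ θ in (0)..(2 * Real.pi), R 0 θ r₀ = 0)
    (hμ : ∫ θ in (0)..(2 * Real.pi), S 0 θ r₀ ≠ 0) :
    ∃ η, 0 < η ∧ η ≤ η₁ ∧ ∃ ε₀, 0 < ε₀ ∧ ε₀ ≤ ε₁ ∧ ∀ ε, 0 < ε → ε ≤ ε₀ →
      ∃ u : ℝ → ℝ, Function.Periodic u (2 * Real.pi) ∧ (∀ θ, |u θ - r₀| < η) ∧
        (∀ θ, HasDerivAt u (ε * R ε θ (u θ)) θ) ∧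
        ∀ (r Θ ω : ℝ → ℝ) (T : ℝ), (∀ t, |r t - r₀| < η) → (∀ t, 0 < ω t) →
          (∀ t, HasDerivAt Θ (ω t) t) →
          (∀ t, HasDerivAt r (ω t * (ε * R ε (Θ t) (r t))) t) → 0 < T →
          Function.Periodic r T →
          (∀ t, ∃ k : ℤ, Θ (t + T) = Θ t + k * (2 * Real.pi)) → ∀ t, r t = u (Θ t) := by
  have hπ := Real.pi_pos
  set μ := ∫ θ in (0)..(2 * Real.pi), S 0 θ r₀ with hμdef
  have hμ0 : 0 < |μ| := abs_pos.2 hμ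
  obtain ⟨⟨C, hC⟩, hRu⟩ := uniform_near_slice hη₁ hε₁ hR hRp
  obtain ⟨⟨B, hB⟩, hSu⟩ := uniform_near_slice hη₁ hε₁ hS hSp
  have hr₀ : r₀ ∈ Icc (r₀ - η₁) (r₀ + η₁) := ⟨by linarith, by linarith⟩
  have h00 : (0:ℝ) ∈ Icc 0 ε₁ := ⟨le_rfl, hε₁.le⟩
  have hC0 : 0 ≤ C := (abs_nonneg _).trans (hC 0 h00 0 r₀ hr₀)
  have hB0 : 0 ≤ B := (abs_nonneg _).trans (hB 0 h00 0 r₀ hr₀)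
  set κ := |μ| / (8 * Real.pi) with hκ
  have hκ0 : 0 < κ := by positivity
  obtain ⟨d, hd, hSd⟩ := hSu κ hκ0
  set η := min η₁ (d / 2) with hη
  have hη0 : 0 < η := lt_min hη₁ (by linarith)
  have hηη₁ : η ≤ η₁ := min_le_left _ _
  have hηd : η < d := (min_le_right _ _).trans_lt (by linarith)
  set δ := |μ| * η / (32 * Real.pi) with hδ
  have hδ0 : 0 < δ := by positivity
  obtain ⟨d', hd', hRd⟩ := hRu δ hδ0
  set ε₀ := min (min ε₁ (d / 2)) (min (d' / 2)
    (min (η / (8 * Real.pi * (C + 1))) (|μ| * η / (64 * Real.pi ^ 2 * ((B + 1) * (C + 1))))))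
    with hε₀
  have hε₀0 : 0 < ε₀ := by
    refine lt_min (lt_min hε₁ (by linarith)) (lt_min (by linarith) (lt_min ?_ ?_)) <;> positivity
  refine ⟨η, hη0, hηη₁, ε₀, hε₀0, (min_le_left _ _).trans (min_le_left _ _), fun ε hε hεε₀ => ?_⟩
  have e1 : ε ≤ ε₁ := hεε₀.trans ((min_le_left _ _).trans (min_le_left _ _))
  have e2 : ε < d :=
    (hεε₀.trans ((min_le_left _ _).trans (min_le_right _ _))).trans_lt (by linarith)
  have e3 : ε < d' := (hεε₀.trans ((min_le_right _ _).trans (min_le_left _ _))).trans_lt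
    (by linarith)
  have e4 : ε ≤ η / (8 * Real.pi * (C + 1)) :=
    hεε₀.trans ((min_le_right _ _).trans ((min_le_right _ _).trans (min_le_left _ _)))
  have e5 : ε ≤ |μ| * η / (64 * Real.pi ^ 2 * ((B + 1) * (C + 1))) :=
    hεε₀.trans ((min_le_right _ _).trans ((min_le_right _ _).trans (min_le_right _ _)))
  rw [le_div_iff₀ (by positivity)] at e4 e5
  have hεI : ε ∈ Icc 0 ε₁ := ⟨hε.le, e1⟩
  have hsub : Icc (r₀ - η) (r₀ + η) ⊆ Icc (r₀ - η₁) (r₀ + η₁) :=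
    Icc_subset_Icc (by linarith) (by linarith)
  have hScont : Continuous fun θ => S 0 θ r₀ := by
    rw [← continuousOn_univ]
    exact hS.comp (f := fun θ : ℝ => ((0:ℝ), θ, r₀)) (s := univ) (by fun_prop)
      (fun θ _ => ⟨h00, mem_univ _, hr₀⟩)
  have hRcont : Continuous fun θ => R 0 θ r₀ := by
    rw [← continuousOn_univ]
    exact hR.comp (f := fun θ : ℝ => ((0:ℝ), θ, r₀)) (s := univ) (by fun_prop)
      (fun θ _ => ⟨h00, mem_univ _, hr₀⟩)
  have hlip : ∀ θ, ∀ r ∈ Icc (r₀ - η) (r₀ + η), ∀ r' ∈ Icc (r₀ - η) (r₀ + η),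
      |R ε θ r - R ε θ r' - S 0 θ r₀ * (r - r')| ≤ κ * |r - r'| := by
    intro θ r hr r' hr'
    have h := (convex_Icc (r₀ - η) (r₀ + η)).norm_image_sub_le_of_norm_hasDerivWithin_le (C := κ)
      (f := fun r => R ε θ r - S 0 θ r₀ * r) (f' := fun r => S ε θ r - S 0 θ r₀)
      (fun x hx => (((hRS ε hεI θ x (hsub hx)).sub
        (((hasDerivAt_id x).const_mul (S 0 θ r₀)))).congr_deriv (by ring)).hasDerivWithinAt)
      (fun x hx => (hSd ε hεI e2 θ x (hsub hx) (by
        have : |x - r₀| ≤ η := by rw [abs_le]; constructor <;> linarith [hx.1, hx.2]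
        linarith)).le) hr' hr
    rw [Real.norm_eq_abs, Real.norm_eq_abs] at h
    refine le_trans (le_of_eq ?_) h
    congr 1; ring
  have hvcont : ContinuousOn (Function.uncurry (R ε)) (univ ×ˢ Icc (r₀ - η) (r₀ + η)) :=
    hR.comp (f := fun p : ℝ × ℝ => (ε, p.1, p.2)) (by fun_prop)
      (fun p hp => ⟨hεI, mem_univ _, hsub hp.2⟩)
  obtain ⟨u, hu1, hu2, hu3⟩ := exists_periodic_solution (v := R ε) (S := fun θ => S 0 θ r₀)
    (R₀ := fun θ => R 0 θ r₀) (r₀ := r₀) (η := η) (ε := ε) (κ := κ) (δ := δ) (C := C) (B := B)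
    (μ := μ) hη0 hε hκ0.le hvcont (hRp ε) hlip
    (fun θ => (hRd ε hεI e3 θ r₀ hr₀ (by simpa using hd')).le)
    (fun θ r hr => hC ε hεI θ r (hsub hr)) hScont hRcont (fun θ => hB 0 h00 θ r₀ hr₀) h0 rfl
    (by nlinarith [mul_pos hε hπ])
    (by
      have f1 : 2 * Real.pi * (κ * η) = |μ| * η / 4 := by rw [hκ]; field_simp; ring
      have f2 : 2 * Real.pi * δ = |μ| * η / 16 := by rw [hδ]; field_simp; ring
      have f3 : B * C ≤ (B + 1) * (C + 1) := by nlinarith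
      have f4 : 2 * Real.pi * (B * (2 * Real.pi * (ε * C))) =
        (4 * Real.pi ^ 2 * ε) * (B * C) := by ring
      have f5 : (4 * Real.pi ^ 2 * ε) * (B * C) ≤ (4 * Real.pi ^ 2 * ε) * ((B + 1) * (C + 1)) := by
        gcongr
      have f6 : 0 < |μ| * η := by positivity
      rw [mul_add, mul_add, f1, f2, f4]
      linarith)
  refine ⟨u, hu1, hu2, hu3, fun r Θ ω T h1 h2 h3 h4 h5 h6 h7 t => ?_⟩
  exact eq_periodic_solution (v := R ε) (S := fun θ => S 0 θ r₀) (κ := κ) (μ := μ) hε hlip hScont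
    (fun θ => hSp 0 θ r₀) rfl (by rw [hκ]; field_simp; norm_num) hu1 hu2 hu3 h1 h2 h3 h4 h5 h6 h7 t

end Averaging

section Charts
open Set Topology

lemma isPeriodicOrbit_of_reparam {V : ℝ × ℝ → ℝ × ℝ} {P : ℝ → ℝ × ℝ} {κ : ℝ → ℝ} {p : ℝ}
    (hp : 0 < p) (hκ : Continuous κ) (hpos : ∀ θ, 0 < κ θ) (hκp : Function.Periodic κ p)
    (hPp : Function.Periodic P p) (hP : ∀ θ, HasDerivAt P (κ θ • V (P θ)) θ)
    (hne : ∃ θ₁ θ₂, P θ₁ ≠ P θ₂) : IsPeriodicOrbit V (range P) := by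
  set τ : ℝ → ℝ := fun θ => ∫ x in (0:ℝ)..θ, κ x with hτ
  have hintg : ∀ a b, IntervalIntegrable κ MeasureTheory.volume a b :=
    fun a b => hκ.intervalIntegrable a b
  have hd : ∀ θ, HasDerivAt τ (κ θ) θ := fun θ =>
    intervalIntegral.integral_hasDerivAt_right (hintg _ _)
      (hκ.stronglyMeasurableAtFilter _ _) hκ.continuousAt
  have hmono : StrictMono τ := strictMono_of_hasDerivAt_pos hd hpos
  have h0 : 0 < ∫ x in (0:ℝ)..p, κ x :=
    intervalIntegral.intervalIntegral_pos_of_pos (hintg _ _) hpos hp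
  have hcont : Continuous τ := continuous_iff_continuousAt.2 fun θ => (hd θ).continuousAt
  have hsurj : Function.Surjective τ := hcont.surjective
    (hκp.tendsto_atTop_intervalIntegral_of_pos h0 hp)
    (hκp.tendsto_atBot_intervalIntegral_of_pos h0 hp)
  set e := hmono.orderIsoOfSurjective τ hsurj with he
  have hτe : ∀ t, τ (e.symm t) = t := fun t => e.apply_symm_apply t
  have heτ : ∀ θ, e.symm (τ θ) = θ := fun θ => e.symm_apply_apply θ
  have hde : ∀ t, HasDerivAt e.symm (κ (e.symm t))⁻¹ t := fun t =>
    HasDerivAt.of_local_left_inverse e.symm.continuous.continuousAt (hd _) (hpos _).ne'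
      (Eventually.of_forall hτe)
  have hτp : ∀ θ, τ (θ + p) = τ θ + τ p := fun θ => by
    have := intervalIntegral.integral_add_adjacent_intervals (hintg 0 θ) (hintg θ (θ + p))
    have h2 := hκp.intervalIntegral_add_eq θ 0
    rw [zero_add] at h2
    simp only [hτ]
    rw [← this, h2]
  refine ⟨fun t => P (e.symm t), fun t => ?_, ⟨τ p, h0, fun t => ?_⟩, ?_, ?_⟩
  · refine ((hP (e.symm t)).scomp t (hde t)).congr_deriv ?_
    rw [smul_smul, inv_mul_cancel₀ (hpos _).ne', one_smul]
  · have : e.symm (t + τ p) = e.symm t + p := by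
      rw [← heτ (e.symm t + p), hτp, hτe]
    change P (e.symm (t + τ p)) = P (e.symm t)
    rw [this, hPp]
  · obtain ⟨a, b, hab⟩ := hne
    exact ⟨τ a, τ b, by simpa only [heτ] using hab⟩
  · exact (e.symm.surjective.range_comp P).symm

lemma exists_polar_lift {s Y ds dY : ℝ → ℝ} (hs : ∀ t, HasDerivAt s (ds t) t)
    (hY : ∀ t, HasDerivAt Y (dY t) t) (hds : Continuous ds) (hdY : Continuous dY)
    (hpos : ∀ t, 0 < s t ^ 2 + Y t ^ 2) :
    ∃ Θ : ℝ → ℝ, (∀ t, HasDerivAt Θ ((Y t * ds t - s t * dY t) / (s t ^ 2 + Y t ^ 2)) t) ∧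
      ∀ t, s t = √(s t ^ 2 + Y t ^ 2) * Real.cos (Θ t) ∧
        Y t = -(√(s t ^ 2 + Y t ^ 2) * Real.sin (Θ t)) := by
  have hsc : Continuous s := continuous_iff_continuousAt.2 fun θ => (hs θ).continuousAt
  have hYc : Continuous Y := continuous_iff_continuousAt.2 fun θ => (hY θ).continuousAt
  set ω : ℝ → ℝ := fun t => (Y t * ds t - s t * dY t) / (s t ^ 2 + Y t ^ 2) with hω
  have hωc : Continuous ω :=
    ((hYc.mul hds).sub (hsc.mul hdY)).div ((hsc.pow 2).add (hYc.pow 2)) fun t => (hpos t).ne'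
  obtain ⟨Θ₀, hc0, hs0⟩ : ∃ Θ₀ : ℝ, s 0 = √(s 0 ^ 2 + Y 0 ^ 2) * Real.cos Θ₀ ∧
      Y 0 = -(√(s 0 ^ 2 + Y 0 ^ 2) * Real.sin Θ₀) := by
    set z : ℂ := ⟨s 0, -Y 0⟩ with hz
    have hn : ‖z‖ = √(s 0 ^ 2 + Y 0 ^ 2) := by
      rw [Complex.norm_def, Complex.normSq_apply]
      congr 1
      simp only [hz]; ring
    refine ⟨Complex.arg z, ?_, ?_⟩
    · rw [← hn, Complex.norm_mul_cos_arg]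
    · rw [← hn, Complex.norm_mul_sin_arg]; simp [hz]
  set Θ : ℝ → ℝ := fun t => Θ₀ + ∫ x in (0:ℝ)..t, ω x with hΘ
  have hΘd : ∀ t, HasDerivAt Θ (ω t) t := fun t =>
    (intervalIntegral.integral_hasDerivAt_right (hωc.intervalIntegrable _ _)
      (hωc.stronglyMeasurableAtFilter _ _) hωc.continuousAt).const_add Θ₀
  have hΘ0 : Θ 0 = Θ₀ := by simp [hΘ]
  set n : ℝ → ℝ := fun t => √(s t ^ 2 + Y t ^ 2) with hn
  have hn0 : ∀ t, 0 < n t := fun t => Real.sqrt_pos.2 (hpos t)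
  have hn2 : ∀ t, n t ^ 2 = s t ^ 2 + Y t ^ 2 := fun t => Real.sq_sqrt (hpos t).le
  have hnd : ∀ t, HasDerivAt n ((s t * ds t + Y t * dY t) / n t) t := fun t => by
    refine ((((hs t).pow 2).add ((hY t).pow 2)).sqrt (hpos t).ne').congr_deriv ?_
    change _ / (2 * n t) = _
    have := (hn0 t).ne'
    field_simp
    simp
    ring
  have hc : ∀ t, HasDerivAt (fun t => Real.cos (Θ t)) (-Real.sin (Θ t) * ω t) t :=
    fun t => (hΘd t).cos
  have hsn : ∀ t, HasDerivAt (fun t => Real.sin (Θ t)) (Real.cos (Θ t) * ω t) t :=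
    fun t => (hΘd t).sin
  have hωn : ∀ t, ω t = (Y t * ds t - s t * dY t) / n t ^ 2 := fun t => by rw [hn2]
  have key : ∀ A : ℝ → ℝ, ∀ A' : ℝ → ℝ, (∀ t, HasDerivAt A (A' t) t) →
      (∀ t, A' t * n t ^ 2 = (s t * ds t + Y t * dY t) * A t) →
      ∀ t, A t / n t = A 0 / n 0 := by
    intro A A' hA hAn t
    have hd : ∀ t, HasDerivAt (fun t => A t / n t) 0 t := fun t => by
      refine ((hA t).div (hnd t) (hn0 t).ne').congr_deriv ?_
      have := (hn0 t).ne'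
      field_simp
      linear_combination hAn t
    exact is_const_of_deriv_eq_zero (fun t => (hd t).differentiableAt)
      (fun t => (hd t).deriv) t 0
  have hp := key (fun t => s t * Real.cos (Θ t) - Y t * Real.sin (Θ t)) _
    (fun t => ((hs t).mul (hc t)).sub ((hY t).mul (hsn t))) (fun t => by
      have h1 : ω t * (s t ^ 2 + Y t ^ 2) = Y t * ds t - s t * dY t := by
        rw [hω]; exact div_mul_cancel₀ _ (hpos t).ne'
      rw [hn2]
      linear_combination (-s t * Real.sin (Θ t) - Y t * Real.cos (Θ t)) * h1)
  have hq := key (fun t => s t * Real.sin (Θ t) + Y t * Real.cos (Θ t)) _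
    (fun t => ((hs t).mul (hsn t)).add ((hY t).mul (hc t))) (fun t => by
      have h1 : ω t * (s t ^ 2 + Y t ^ 2) = Y t * ds t - s t * dY t := by
        rw [hω]; exact div_mul_cancel₀ _ (hpos t).ne'
      rw [hn2]
      linear_combination (s t * Real.cos (Θ t) - Y t * Real.sin (Θ t)) * h1)
  refine ⟨Θ, hΘd, fun t => ?_⟩
  have hp' := hp t
  have hq' := hq t
  simp only [hΘ0] at hp' hq'
  change s 0 = n 0 * _ at hc0
  change Y 0 = -(n 0 * _) at hs0
  have e1 : s 0 * Real.cos Θ₀ - Y 0 * Real.sin Θ₀ = n 0 := by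
    rw [hc0, hs0]; linear_combination n 0 * Real.sin_sq_add_cos_sq Θ₀
  have e2 : s 0 * Real.sin Θ₀ + Y 0 * Real.cos Θ₀ = 0 := by
    rw [hc0, hs0]; ring
  rw [e1, div_self (hn0 0).ne', div_eq_one_iff_eq (hn0 t).ne'] at hp'
  rw [e2, zero_div, div_eq_zero_iff, or_iff_left (hn0 t).ne'] at hq'
  change s t = n t * _ ∧ Y t = -(n t * _)
  have h3 := Real.sin_sq_add_cos_sq (Θ t)
  constructor
  · linear_combination (-s t) * h3 + Real.cos (Θ t) * hp' + Real.sin (Θ t) * hq'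
  · linear_combination (-Y t) * h3 - Real.sin (Θ t) * hp' + Real.cos (Θ t) * hq'

lemma exists_inverse_of_deriv_pos {f df : ℝ → ℝ} {a b : ℝ}
    (hd : ∀ s ∈ Ioo a b, HasDerivAt f (df s) s) (hc : ContinuousOn df (Ioo a b))
    (hpos : ∀ s ∈ Ioo a b, 0 < df s) :
    StrictMonoOn f (Ioo a b) ∧ IsOpen (f '' Ioo a b) ∧ ∃ σ : ℝ → ℝ,
      (∀ s ∈ Ioo a b, σ (f s) = s) ∧ ∀ s ∈ Ioo a b, HasDerivAt σ (df s)⁻¹ (f s) := by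
  have hmono : StrictMonoOn f (Ioo a b) :=
    strictMonoOn_of_hasDerivWithinAt_pos (convex_Ioo _ _)
      (fun s hs => (hd s hs).continuousAt.continuousWithinAt)
      (fun s hs => (hd s (interior_subset hs)).hasDerivWithinAt)
      (fun s hs => hpos s (interior_subset hs))
  have hmap : ∀ s ∈ Ioo a b, map f (𝓝 s) = 𝓝 (f s) := fun s hs => by
    have hst : HasStrictDerivAt f (df s) s :=
      hasStrictDerivAt_of_hasDerivAt_of_continuousAt
        (by filter_upwards [isOpen_Ioo.mem_nhds hs] with y hy using hd y hy)
        (hc.continuousAt (isOpen_Ioo.mem_nhds hs))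
    exact hst.map_nhds_eq (hpos s hs).ne'
  have hleft : ∀ s ∈ Ioo a b, Function.invFunOn f (Ioo a b) (f s) = s := fun s hs =>
    hmono.injOn.leftInvOn_invFunOn hs
  refine ⟨hmono, ?_, Function.invFunOn f (Ioo a b), hleft, fun s hs => ?_⟩
  · rw [isOpen_iff_mem_nhds]
    rintro _ ⟨s, hs, rfl⟩
    rw [← hmap s hs]
    exact image_mem_map (isOpen_Ioo.mem_nhds hs)
  · have hd' : HasDerivAt f (df s) (Function.invFunOn f (Ioo a b) (f s)) :=
      (hleft s hs).symm ▸ hd s hs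
    refine HasDerivAt.of_local_left_inverse ?_ hd' (hpos s hs).ne' ?_
    · rw [ContinuousAt, ← hmap s hs, tendsto_map'_iff]
      refine Tendsto.congr' (f₁ := id) ?_ ?_
      · filter_upwards [isOpen_Ioo.mem_nhds hs] with y hy using (hleft y hy).symm
      · rw [hleft s hs]; exact tendsto_id
    · rw [← hmap s hs, eventually_map]
      filter_upwards [isOpen_Ioo.mem_nhds hs] with y hy using by rw [hleft y hy]

/-- A coordinate `x = ξ s` in which the potential `G` becomes `s ^ 2 / 2` up to a constant. -/
structure IsChart (G : ℝ[X]) (ξ dξ : ℝ → ℝ) (ρ : ℝ) : Prop where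
  pos : 0 < ρ
  hasDerivAt : ∀ s ∈ Ioo (-ρ) ρ, HasDerivAt ξ (dξ s) s
  cont : ContinuousOn dξ (Ioo (-ρ) ρ)
  dpos : ∀ s ∈ Ioo (-ρ) ρ, 0 < dξ s
  eq : ∀ s ∈ Ioo (-ρ) ρ, G.derivative.eval (ξ s) * dξ s = s

lemma IsChart.continuousOn {G : ℝ[X]} {ξ dξ : ℝ → ℝ} {ρ : ℝ} (h : IsChart G ξ dξ ρ) :
    ContinuousOn ξ (Ioo (-ρ) ρ) := fun s hs => (h.hasDerivAt s hs).continuousAt.continuousWithinAt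

lemma IsChart.strictMonoOn {G : ℝ[X]} {ξ dξ : ℝ → ℝ} {ρ : ℝ} (h : IsChart G ξ dξ ρ) :
    StrictMonoOn ξ (Ioo (-ρ) ρ) := (exists_inverse_of_deriv_pos h.hasDerivAt h.cont h.dpos).1

end Charts

section Dynamics
open Set Topology

lemma surjective_of_periodic_deriv {Θ ω : ℝ → ℝ} {T : ℝ} (hΘ : ∀ t, HasDerivAt Θ (ω t) t)
    (hω : Continuous ω) (hpos : ∀ t, 0 < ω t) (hT : 0 < T) (hp : Function.Periodic ω T) :
    Function.Surjective Θ := by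
  have hintg : ∀ a b, IntervalIntegrable ω MeasureTheory.volume a b :=
    fun a b => hω.intervalIntegrable a b
  have h0 : 0 < ∫ x in (0:ℝ)..T, ω x :=
    intervalIntegral.intervalIntegral_pos_of_pos (hintg _ _) hpos hT
  have heq : Θ = fun t => Θ 0 + ∫ x in (0:ℝ)..t, ω x := by
    funext t
    rw [intervalIntegral.integral_eq_sub_of_hasDerivAt (fun x _ => hΘ x) (hintg 0 t)]
    ring
  have hc : Continuous Θ := continuous_iff_continuousAt.2 fun θ => (hΘ θ).continuousAt
  refine hc.surjective ?_ ?_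
  · rw [heq]
    exact tendsto_atTop_add_const_left _ _ (hp.tendsto_atTop_intervalIntegral_of_pos h0 hT)
  · rw [heq]
    exact tendsto_atBot_add_const_left _ _ (hp.tendsto_atBot_intervalIntegral_of_pos h0 hT)

lemma mul_cos_mem_Ioo {r ρ : ℝ} (h0 : 0 < r) (h : r < ρ) (θ : ℝ) :
    r * Real.cos θ ∈ Ioo (-ρ) ρ := by
  have h1 := Real.neg_one_le_cos θ
  have h2 := Real.cos_le_one θ
  constructor <;> nlinarith

lemma polar_averaging {Φ dΦ : ℝ → ℝ} {ρ a r₀ b : ℝ}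
    (hΦ : ∀ s ∈ Ioo (-ρ) ρ, HasDerivAt Φ (dΦ s) s) (hdΦ : ContinuousOn dΦ (Ioo (-ρ) ρ))
    (ha : 0 < a) (har : a < r₀) (hrb : r₀ < b) (hb : b < ρ)
    (h0 : ∫ θ in (0:ℝ)..(2 * Real.pi), Φ (r₀ * Real.cos θ) * Real.cos θ = 0)
    (hμ : ∫ θ in (0:ℝ)..(2 * Real.pi), dΦ (r₀ * Real.cos θ) * Real.cos θ ^ 2 ≠ 0) :
    ∃ η, 0 < η ∧ a < r₀ - η ∧ r₀ + η < b ∧ ∃ ε₀, 0 < ε₀ ∧ ∀ ε, 0 < ε → ε ≤ ε₀ →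
      (∀ θ r, |r - r₀| < η → 0 < r + ε * Φ (r * Real.cos θ) * Real.sin θ) ∧
      ∃ u : ℝ → ℝ, Function.Periodic u (2 * Real.pi) ∧ (∀ θ, |u θ - r₀| < η) ∧
        (∀ θ, HasDerivAt u (-(ε * u θ * Φ (u θ * Real.cos θ) * Real.cos θ) /
          (u θ + ε * Φ (u θ * Real.cos θ) * Real.sin θ)) θ) ∧
        ∀ (r Θ ω : ℝ → ℝ) (T : ℝ), (∀ t, |r t - r₀| < η) → (∀ t, 0 < ω t) →
          (∀ t, HasDerivAt Θ (ω t) t) →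
          (∀ t, HasDerivAt r (ω t * (-(ε * r t * Φ (r t * Real.cos (Θ t)) * Real.cos (Θ t)) /
            (r t + ε * Φ (r t * Real.cos (Θ t)) * Real.sin (Θ t)))) t) →
          0 < T → Function.Periodic r T →
          (∀ t, ∃ k : ℤ, Θ (t + T) = Θ t + k * (2 * Real.pi)) → ∀ t, r t = u (Θ t) := by
  obtain ⟨η₁, hη₁, hηa, hηb⟩ : ∃ η₁, 0 < η₁ ∧ a < r₀ - η₁ ∧ r₀ + η₁ < b := by
    refine ⟨min (r₀ - a) (b - r₀) / 2, ?_, ?_, ?_⟩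
    · have : 0 < min (r₀ - a) (b - r₀) := lt_min (by linarith) (by linarith)
      linarith
    · have := min_le_left (r₀ - a) (b - r₀); linarith
    · have := min_le_right (r₀ - a) (b - r₀); linarith
  have hΦc : ContinuousOn Φ (Ioo (-ρ) ρ) :=
    fun s hs => (hΦ s hs).continuousAt.continuousWithinAt
  obtain ⟨C, hC⟩ : ∃ C, ∀ s ∈ Icc (-b) b, ‖Φ s‖ ≤ C :=
    isCompact_Icc.exists_bound_of_continuousOn
      (hΦc.mono fun s hs => ⟨by linarith [hs.1], by linarith [hs.2]⟩)
  have hb0 : 0 < b := by linarith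
  have hC0 : 0 ≤ C := (norm_nonneg _).trans (hC 0 ⟨by linarith, by linarith⟩)
  set ε₁ := (r₀ - η₁) / (2 * (C + 1)) with hε₁
  have hε₁0 : 0 < ε₁ := div_pos (by linarith) (by linarith)
  have hmem : ∀ r ∈ Icc (r₀ - η₁) (r₀ + η₁), ∀ θ, r * Real.cos θ ∈ Ioo (-ρ) ρ := fun r hr θ =>
    mul_cos_mem_Ioo (by linarith [hr.1]) (by linarith [hr.2]) θ
  have hD : ∀ ε ∈ Icc 0 ε₁, ∀ θ, ∀ r ∈ Icc (r₀ - η₁) (r₀ + η₁),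
      0 < r + ε * Φ (r * Real.cos θ) * Real.sin θ := by
    intro ε hε θ r hr
    have hs := mul_cos_mem_Ioo (r := r) (ρ := b) (by linarith [hr.1]) (by linarith [hr.2]) θ
    have h1 : |Φ (r * Real.cos θ)| ≤ C := hC _ ⟨hs.1.le, hs.2.le⟩
    have h2 : |ε * Φ (r * Real.cos θ) * Real.sin θ| ≤ ε₁ * C := by
      rw [abs_mul, abs_mul, abs_of_nonneg hε.1]
      calc _ ≤ ε₁ * C * 1 := mul_le_mul (mul_le_mul hε.2 h1 (abs_nonneg _) hε₁0.le)
            (Real.abs_sin_le_one θ) (abs_nonneg _) (by positivity)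
        _ = _ := mul_one _
    have h3 : ε₁ * (2 * (C + 1)) = r₀ - η₁ := div_mul_cancel₀ _ (by positivity)
    have h4 := neg_le_of_abs_le h2
    nlinarith [hr.1]
  have hcomp : ∀ {f : ℝ → ℝ}, ContinuousOn f (Ioo (-ρ) ρ) →
      ContinuousOn (fun p : ℝ × ℝ × ℝ => f (p.2.2 * Real.cos p.2.1))
        (Icc 0 ε₁ ×ˢ univ ×ˢ Icc (r₀ - η₁) (r₀ + η₁)) := fun hf =>
    hf.comp (by fun_prop) fun p hp => hmem _ hp.2.2 _
  have hΦ1 := hcomp hΦc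
  have hΦ2 := hcomp hdΦ
  set K : Set (ℝ × ℝ × ℝ) := Icc 0 ε₁ ×ˢ univ ×ˢ Icc (r₀ - η₁) (r₀ + η₁)
  have c1 : ContinuousOn (fun p : ℝ × ℝ × ℝ => p.1) K := by fun_prop
  have c2 : ContinuousOn (fun p : ℝ × ℝ × ℝ => p.2.2) K := by fun_prop
  have cc : ContinuousOn (fun p : ℝ × ℝ × ℝ => Real.cos p.2.1) K := by fun_prop
  have cs : ContinuousOn (fun p : ℝ × ℝ × ℝ => Real.sin p.2.1) K := by fun_prop
  have key := averaging
    (R := fun ε θ r => -(r * Φ (r * Real.cos θ) * Real.cos θ) /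
      (r + ε * Φ (r * Real.cos θ) * Real.sin θ))
    (S := fun ε θ r => -((Φ (r * Real.cos θ) * Real.cos θ +
        r * (dΦ (r * Real.cos θ) * Real.cos θ) * Real.cos θ) *
        (r + ε * Φ (r * Real.cos θ) * Real.sin θ) - (r * Φ (r * Real.cos θ) * Real.cos θ) *
        (1 + ε * (dΦ (r * Real.cos θ) * Real.cos θ) * Real.sin θ)) /
      (r + ε * Φ (r * Real.cos θ) * Real.sin θ) ^ 2) (r₀ := r₀) hη₁ hε₁0
    (((c2.mul hΦ1).mul cc).neg.div (c2.add ((c1.mul hΦ1).mul cs))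
      fun p hp => (hD _ hp.1 _ _ hp.2.2).ne')
    ((((((hΦ1.mul cc).add ((c2.mul (hΦ2.mul cc)).mul cc)).mul
      (c2.add ((c1.mul hΦ1).mul cs))).sub (((c2.mul hΦ1).mul cc).mul
      (continuousOn_const.add ((c1.mul (hΦ2.mul cc)).mul cs)))).neg).div
      ((c2.add ((c1.mul hΦ1).mul cs)).pow 2)
      fun p hp => (pow_pos (hD _ hp.1 _ _ hp.2.2) 2).ne')
    (fun ε hε θ r hr => by
      have h1 : HasDerivAt (fun r => r * Real.cos θ) (Real.cos θ) r := hasDerivAt_mul_const _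
      have h2 : HasDerivAt (fun r => Φ (r * Real.cos θ)) (dΦ (r * Real.cos θ) * Real.cos θ) r :=
        (hΦ _ (hmem r hr θ)).comp r h1
      refine ((((hasDerivAt_id' r).mul h2).mul_const (Real.cos θ)).neg.div
        ((hasDerivAt_id' r).add ((h2.const_mul ε).mul_const (Real.sin θ)))
        (hD ε hε θ r hr).ne').congr_deriv ?_
      simp only [Pi.neg_apply, Pi.mul_apply, Pi.add_apply]
      ring)
    (fun ε θ r => by simp only [Real.cos_add_two_pi, Real.sin_add_two_pi])
    (fun ε θ r => by simp only [Real.cos_add_two_pi, Real.sin_add_two_pi])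
    (by
      refine neg_eq_zero.1 ((intervalIntegral.integral_neg (μ := MeasureTheory.volume)
        (E := ℝ)).symm.trans (Eq.trans ?_ h0))
      refine intervalIntegral.integral_congr fun θ _ => ?_
      have : r₀ ≠ 0 := by linarith
      simp only [zero_mul, add_zero]
      rw [neg_div, neg_neg, div_eq_iff this]
      ring)
    (by
      refine neg_ne_zero.1 fun h => hμ ?_
      rw [← intervalIntegral.integral_neg] at h
      refine Eq.trans ?_ h
      refine intervalIntegral.integral_congr fun θ _ => ?_
      have : r₀ ≠ 0 := by linarith
      simp only [zero_mul, add_zero]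
      rw [neg_div, neg_neg, eq_div_iff (pow_ne_zero 2 this)]
      ring)
  obtain ⟨η, hη, hηη, ε₀, hε₀, hεε, H⟩ := key
  refine ⟨η, hη, by linarith, by linarith, ε₀, hε₀, fun ε hε hεε₀ => ⟨fun θ r hr => ?_, ?_⟩⟩
  · rw [abs_lt] at hr
    exact hD ε ⟨hε.le, hεε₀.trans hεε⟩ θ r ⟨by linarith [hr.1], by linarith [hr.2]⟩
  · obtain ⟨u, hup, hub, hud, huu⟩ := H ε hε hεε₀
    refine ⟨u, hup, hub, fun θ => (hud θ).congr_deriv (by ring), ?_⟩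
    intro r Θ ω T h1 h2 h3 h4
    exact huu r Θ ω T h1 h2 h3 fun t => (h4 t).congr_deriv (by ring)

end Dynamics

section LimitCycles
open Set Topology

lemma IsChart.hasDerivAt_eval {G : ℝ[X]} {ξ dξ : ℝ → ℝ} {ρ : ℝ} (h : IsChart G ξ dξ ρ)
    (F : ℝ[X]) {s : ℝ} (hs : s ∈ Ioo (-ρ) ρ) :
    HasDerivAt (fun s => F.eval (ξ s)) (F.derivative.eval (ξ s) * dξ s) s :=
  (F.hasDerivAt (ξ s)).comp s (h.hasDerivAt s hs)

lemma IsChart.continuousOn_eval {G : ℝ[X]} {ξ dξ : ℝ → ℝ} {ρ : ℝ} (h : IsChart G ξ dξ ρ)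
    (F : ℝ[X]) : ContinuousOn (fun s => F.eval (ξ s)) (Ioo (-ρ) ρ) :=
  F.continuous.comp_continuousOn h.continuousOn

lemma exists_limitCycle {F G : ℝ[X]} {ξ dξ : ℝ → ℝ} {ρ a r₀ b : ℝ} (h : IsChart G ξ dξ ρ)
    (ha : 0 < a) (har : a < r₀) (hrb : r₀ < b) (hb : b < ρ)
    (h0 : ∫ θ in (0:ℝ)..(2 * Real.pi), F.eval (ξ (r₀ * Real.cos θ)) * Real.cos θ = 0)
    (hμ : ∫ θ in (0:ℝ)..(2 * Real.pi), F.derivative.eval (ξ (r₀ * Real.cos θ)) *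
      dξ (r₀ * Real.cos θ) * Real.cos θ ^ 2 ≠ 0) :
    ∃ ε₀, 0 < ε₀ ∧ ∀ ε, 0 < ε → ε ≤ ε₀ →
      ∃ Γ, IsLimitCycle (lienard F.derivative G.derivative ε) Γ ∧
        (∃ p ∈ Γ, p.2 + ε * F.eval p.1 = 0) ∧
        ∀ p ∈ Γ, p.2 + ε * F.eval p.1 = 0 → p.1 ∈ ξ '' {s | a < |s| ∧ |s| < b} := by
  obtain ⟨η, hη, hηa, hηb, ε₀, hε₀, H⟩ := polar_averaging
    (Φ := fun s => F.eval (ξ s)) (dΦ := fun s => F.derivative.eval (ξ s) * dξ s)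
    (fun s hs => h.hasDerivAt_eval F hs) ((h.continuousOn_eval F.derivative).mul h.cont)
    ha har hrb hb h0 hμ
  refine ⟨ε₀, hε₀, fun ε hε hεε => ?_⟩
  obtain ⟨hD, u, hup, hub, hud, huu⟩ := H ε hε hεε
  obtain ⟨-, hJ, σ, hσ, hσd⟩ := exists_inverse_of_deriv_pos h.hasDerivAt h.cont h.dpos
  have hbd : ∀ {r}, |r - r₀| < η → a < r ∧ r < b := fun hr => by
    rw [abs_lt] at hr; exact ⟨by linarith [hr.1], by linarith [hr.2]⟩
  have hmem : ∀ {r}, |r - r₀| < η → ∀ θ, r * Real.cos θ ∈ Ioo (-ρ) ρ := fun hr θ =>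
    mul_cos_mem_Ioo (ha.trans (hbd hr).1) ((hbd hr).2.trans hb) θ
  have hu0 : ∀ θ, 0 < u θ := fun θ => ha.trans (hbd (hub θ)).1
  have huc : Continuous u := continuous_iff_continuousAt.2 fun θ => (hud θ).continuousAt
  set V := lienard F.derivative G.derivative ε with hV
  set P : ℝ → ℝ × ℝ := fun θ => (ξ (u θ * Real.cos θ),
    -(u θ * Real.sin θ) - ε * F.eval (ξ (u θ * Real.cos θ))) with hP
  set D : ℝ → ℝ := fun θ => u θ + ε * F.eval (ξ (u θ * Real.cos θ)) * Real.sin θ with hDdef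
  have hD0 : ∀ θ, 0 < D θ := fun θ => hD θ _ (hub θ)
  set κ : ℝ → ℝ := fun θ => u θ * dξ (u θ * Real.cos θ) / D θ with hκ
  have hucc : Continuous fun θ => u θ * Real.cos θ := huc.mul Real.continuous_cos
  have hξc : Continuous fun θ => ξ (u θ * Real.cos θ) :=
    h.continuousOn.comp_continuous hucc fun θ => hmem (hub θ) θ
  have hdξc : Continuous fun θ => dξ (u θ * Real.cos θ) :=
    h.cont.comp_continuous hucc fun θ => hmem (hub θ) θ
  have hκc : Continuous κ := (huc.mul hdξc).div
    (huc.add ((continuous_const.mul (F.continuous.comp hξc)).mul Real.continuous_sin))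
    fun θ => (hD0 θ).ne'
  have hκ0 : ∀ θ, 0 < κ θ := fun θ =>
    div_pos (mul_pos (hu0 θ) (h.dpos _ (hmem (hub θ) θ))) (hD0 θ)
  have hPp : Function.Periodic P (2 * Real.pi) := fun θ => by
    simp only [hP, hup θ, Real.cos_add_two_pi, Real.sin_add_two_pi]
  have hκp : Function.Periodic κ (2 * Real.pi) := fun θ => by
    simp only [hκ, hDdef, hup θ, Real.cos_add_two_pi, Real.sin_add_two_pi]
  have hPd : ∀ θ, HasDerivAt P (κ θ • V (P θ)) θ := fun θ => by
    have hm := hmem (hub θ) θ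
    have hDθ := (hD0 θ).ne'
    have heq := h.eq _ hm
    have h1 : HasDerivAt (fun θ => u θ * Real.cos θ) (u θ * (P θ).2 / D θ) θ := by
      refine ((hud θ).mul (Real.hasDerivAt_cos θ)).congr_deriv ?_
      change -(ε * u θ * F.eval (ξ (u θ * Real.cos θ)) * Real.cos θ) / D θ * _ + _ = _
      rw [eq_div_iff hDθ, add_mul, div_mul_eq_mul_div, div_mul_cancel₀ _ hDθ]
      simp only [hDdef, hP]
      linear_combination (-ε * u θ * F.eval (ξ (u θ * Real.cos θ))) * Real.sin_sq_add_cos_sq θ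
    have h2 : HasDerivAt (fun θ => ξ (u θ * Real.cos θ))
        (dξ (u θ * Real.cos θ) * (u θ * (P θ).2 / D θ)) θ := (h.hasDerivAt _ hm).comp θ h1
    have h3 := ((hud θ).mul (Real.hasDerivAt_sin θ)).neg.sub
      (((F.hasDerivAt (ξ (u θ * Real.cos θ))).comp θ h2).const_mul ε)
    refine (h2.prodMk h3).congr_deriv ?_
    refine Prod.ext ?_ ?_
    · simp only [hV, lienard, hκ, Prod.smul_fst, smul_eq_mul]
      ring
    · simp only [hV, lienard, hκ, Prod.smul_snd, smul_eq_mul]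
      change -(-(ε * u θ * F.eval (ξ (u θ * Real.cos θ)) * Real.cos θ) / D θ * _ + _) - _ = _
      have e1 : (P θ).1 = ξ (u θ * Real.cos θ) := rfl
      rw [e1]
      field_simp
      simp only [hDdef]
      linear_combination u θ * heq
  have hPer : IsPeriodicOrbit V (range P) := by
    refine isPeriodicOrbit_of_reparam (by positivity) hκc hκ0 hκp hPp hPd ⟨0, Real.pi, ?_⟩
    intro he
    have h1 := congrArg Prod.fst he
    simp only [hP] at h1
    have h2 := h.strictMonoOn.injOn (hmem (hub _) _) (hmem (hub _) _) h1
    rw [Real.cos_zero, Real.cos_pi] at h2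
    linarith [hu0 0, hu0 Real.pi]
  set N : ℝ × ℝ → ℝ := fun p => √(σ p.1 ^ 2 + (p.2 + ε * F.eval p.1) ^ 2) with hN
  have hNP : ∀ θ, N (P θ) = u θ := fun θ => by
    simp only [hN, hP, hσ _ (hmem (hub θ) θ)]
    rw [← Real.sqrt_sq (hu0 θ).le]
    congr 1
    rw [Real.sqrt_sq (hu0 θ).le]
    linear_combination u θ ^ 2 * Real.sin_sq_add_cos_sq θ
  refine ⟨range P, ⟨hPer, ((ξ '' Ioo (-ρ) ρ) ×ˢ univ) ∩ N ⁻¹' {r | |r - r₀| < η}, ?_, ?_, ?_⟩,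
    ⟨P 0, mem_range_self 0, ?_⟩, ?_⟩
  · refine ContinuousOn.isOpen_inter_preimage ?_ (hJ.prod isOpen_univ)
      (isOpen_lt (by fun_prop) continuous_const)
    have hσc : ContinuousOn (fun p : ℝ × ℝ => σ p.1) ((ξ '' Ioo (-ρ) ρ) ×ˢ univ) := by
      refine ContinuousOn.comp (t := ξ '' Ioo (-ρ) ρ) (g := σ) ?_ continuousOn_fst
        fun p hp => hp.1
      rintro _ ⟨s, hs, rfl⟩
      exact (hσd s hs).continuousAt.continuousWithinAt
    exact ((hσc.pow 2).add (by fun_prop)).sqrt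
  · rintro _ ⟨θ, rfl⟩
    refine ⟨⟨mem_image_of_mem _ (hmem (hub θ) θ), mem_univ _⟩, ?_⟩
    rw [mem_preimage, hNP]
    exact hub θ
  · rintro Γ' ⟨γ, hγ, ⟨T, hT, hγT⟩, -, rfl⟩ hsub
    have hU : ∀ t, γ t ∈ _ := fun t => hsub (mem_range_self t)
    have hγc : Continuous γ := continuous_iff_continuousAt.2 fun t => (hγ t).continuousAt
    set s : ℝ → ℝ := fun t => σ (γ t).1 with hs
    set Y : ℝ → ℝ := fun t => (γ t).2 + ε * F.eval (γ t).1 with hY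
    have hsx : ∀ t, s t ∈ Ioo (-ρ) ρ ∧ ξ (s t) = (γ t).1 := fun t => by
      obtain ⟨s', hs', he⟩ := (hU t).1.1
      have : s t = s' := by rw [hs]; simp only; rw [← he, hσ s' hs']
      rw [this]; exact ⟨hs', he⟩
    have hr : ∀ t, |√(s t ^ 2 + Y t ^ 2) - r₀| < η := fun t => (hU t).2
    have hpos : ∀ t, 0 < s t ^ 2 + Y t ^ 2 := fun t =>
      Real.sqrt_pos.1 (ha.trans (hbd (hr t)).1)
    have hγ1 : ∀ t, HasDerivAt (fun t => (γ t).1) (γ t).2 t := fun t => (hγ t).fst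
    have hγ2 : ∀ t, HasDerivAt (fun t => (γ t).2) (V (γ t)).2 t := fun t => (hγ t).snd
    have hsd : ∀ t, HasDerivAt s ((Y t - ε * F.eval (ξ (s t))) / dξ (s t)) t := fun t => by
      have h1 := hσd _ (hsx t).1
      rw [(hsx t).2] at h1
      refine (h1.comp t (hγ1 t)).congr_deriv ?_
      simp only [hY, (hsx t).2]
      ring
    have hYd : ∀ t, HasDerivAt Y (-(s t) / dξ (s t)) t := fun t => by
      refine ((hγ2 t).add (((F.hasDerivAt _).comp t (hγ1 t)).const_mul ε)).congr_deriv ?_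
      have h1 := h.eq _ (hsx t).1
      rw [(hsx t).2] at h1
      rw [eq_div_iff (h.dpos _ (hsx t).1).ne']
      simp only [hV, lienard]
      linear_combination -h1
    have hsc : Continuous s := continuous_iff_continuousAt.2 fun t => (hsd t).continuousAt
    have hYc : Continuous Y := continuous_iff_continuousAt.2 fun t => (hYd t).continuousAt
    have hdc : Continuous fun t => dξ (s t) := h.cont.comp_continuous hsc fun t => (hsx t).1
    have hFc : Continuous fun t => F.eval (ξ (s t)) :=
      (h.continuousOn_eval F).comp_continuous hsc fun t => (hsx t).1
    have hd0 : ∀ t, dξ (s t) ≠ 0 := fun t => (h.dpos _ (hsx t).1).ne'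
    obtain ⟨Θ, hΘ, hsY⟩ := exists_polar_lift hsd hYd
      ((hYc.sub (continuous_const.mul hFc)).div hdc hd0) (hsc.neg.div hdc hd0) hpos
    set r : ℝ → ℝ := fun t => √(s t ^ 2 + Y t ^ 2) with hrdef
    have hr0 : ∀ t, 0 < r t := fun t => Real.sqrt_pos.2 (hpos t)
    have hr2 : ∀ t, r t ^ 2 = s t ^ 2 + Y t ^ 2 := fun t => Real.sq_sqrt (hpos t).le
    have hs1 : ∀ t, s t = r t * Real.cos (Θ t) := fun t => (hsY t).1
    have hY1 : ∀ t, Y t = -(r t * Real.sin (Θ t)) := fun t => (hsY t).2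
    set ω : ℝ → ℝ := fun t =>
      (r t + ε * F.eval (ξ (s t)) * Real.sin (Θ t)) / (r t * dξ (s t)) with hω
    have hE0 : ∀ t, 0 < r t + ε * F.eval (ξ (s t)) * Real.sin (Θ t) := fun t => by
      rw [hs1]; exact hD (Θ t) (r t) (hr t)
    have hω0 : ∀ t, 0 < ω t := fun t =>
      div_pos (hE0 t) (mul_pos (hr0 t) (h.dpos _ (hsx t).1))
    have hΘd : ∀ t, HasDerivAt Θ (ω t) t := fun t => by
      refine (hΘ t).congr_deriv ?_
      rw [← hr2]
      have h1 := hd0 t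
      have h2 := (hr0 t).ne'
      simp only [hω]
      field_simp
      have h3 := hr2 t
      rw [hY1] at h3 ⊢
      linear_combination -h3
    have hrd : ∀ t, HasDerivAt r
        (ω t * (-(ε * r t * F.eval (ξ (r t * Real.cos (Θ t))) * Real.cos (Θ t)) /
          (r t + ε * F.eval (ξ (r t * Real.cos (Θ t))) * Real.sin (Θ t)))) t := fun t => by
      refine ((((hsd t).pow 2).add ((hYd t).pow 2)).sqrt (hpos t).ne').congr_deriv ?_
      change _ / (2 * r t) = _
      rw [← hs1]
      have h1 := hd0 t
      have h2 := (hr0 t).ne'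
      have h3 := (hE0 t).ne'
      simp only [hω]
      field_simp
      have h4 := hs1 t
      simp only [Nat.cast_ofNat, Nat.add_one_sub_one, pow_one]
      linear_combination (-2 * ε * F.eval (ξ (s t))) * h4
    have hsT : Function.Periodic s T := fun t => by simp only [hs, hγT t]
    have hYT : Function.Periodic Y T := fun t => by simp only [hY, hγT t]
    have hrT : Function.Periodic r T := fun t => by simp only [hrdef, hsT t, hYT t]
    have hk : ∀ t, ∃ k : ℤ, Θ (t + T) = Θ t + k * (2 * Real.pi) := fun t => by
      have h1 : Real.cos (Θ (t + T)) = Real.cos (Θ t) := by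
        have := hs1 (t + T)
        rw [hsT, hrT, hs1 t] at this
        exact (mul_left_cancel₀ (hr0 t).ne' this).symm
      have h2 : Real.sin (Θ (t + T)) = Real.sin (Θ t) := by
        have := hY1 (t + T)
        rw [hYT, hrT, hY1 t] at this
        exact (mul_left_cancel₀ (hr0 t).ne' (neg_injective this)).symm
      obtain ⟨k, hk⟩ := Real.Angle.angle_eq_iff_two_pi_dvd_sub.1 (Real.Angle.cos_sin_inj h1 h2)
      exact ⟨k, by linarith⟩
    have hru := huu r Θ ω T hr hω0 hΘd hrd hT hrT hk
    have hγP : γ = P ∘ Θ := by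
      funext t
      refine Prod.ext ?_ ?_
      · simp only [hP, Function.comp_apply]
        rw [← hru, ← hs1, (hsx t).2]
      · simp only [hP, Function.comp_apply]
        rw [← hru, ← hs1, (hsx t).2, ← hY1]
        simp [hY]
    have hωT : Function.Periodic ω T := fun t => by
      have h1 : Real.sin (Θ (t + T)) = Real.sin (Θ t) := by
        have := hY1 (t + T)
        rw [hYT, hrT, hY1 t] at this
        exact (mul_left_cancel₀ (hr0 t).ne' (neg_injective this)).symm
      simp only [hω, h1, hrT t, hsT t]
    have hΘc : Continuous Θ := continuous_iff_continuousAt.2 fun t => (hΘd t).continuousAt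
    have hωc : Continuous ω :=
      ((hsc.pow 2).add (hYc.pow 2)).sqrt.add ((continuous_const.mul hFc).mul
        (Real.continuous_sin.comp hΘc)) |>.div
        (((hsc.pow 2).add (hYc.pow 2)).sqrt.mul hdc) fun t => (mul_pos (hr0 t)
          (h.dpos _ (hsx t).1)).ne'
    rw [hγP, (surjective_of_periodic_deriv hΘd hωc hω0 hT hωT).range_comp]
  · simp [hP]
  · rintro _ ⟨θ, rfl⟩ hp
    refine ⟨u θ * Real.cos θ, ?_, rfl⟩
    have h1 : u θ * Real.sin θ = 0 := by simp only [hP] at hp; linarith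
    have h2 : Real.sin θ = 0 := (mul_eq_zero.1 h1).resolve_left (hu0 θ).ne'
    have h3 : |Real.cos θ| = 1 := Real.abs_cos_eq_one_iff.2 (Real.sin_eq_zero_iff.1 h2)
    rw [mem_ofPred_eq, abs_mul, h3, mul_one, abs_of_pos (hu0 θ)]
    exact hbd (hub θ)

end LimitCycles

section Melnikov
open Set Topology

/-- The first order Melnikov integral of `F` along the circle of radius `r` of a chart `ξ`. -/
noncomputable def melnikov (ξ : ℝ → ℝ) (F : ℝ[X]) (r : ℝ) : ℝ :=
  ∫ θ in (0:ℝ)..(2 * Real.pi), F.eval (ξ (r * Real.cos θ)) * Real.cos θ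

lemma continuous_comp_mul_cos {f : ℝ → ℝ} {ρ r : ℝ}
    (hf : ContinuousOn f (Ioo (-ρ) ρ)) (h0 : 0 < r) (hr : r < ρ) :
    Continuous fun θ => f (r * Real.cos θ) :=
  hf.comp_continuous (continuous_const.mul Real.continuous_cos) (mul_cos_mem_Ioo h0 hr)

lemma IsChart.continuous_integrand {G : ℝ[X]} {ξ dξ : ℝ → ℝ} {ρ r : ℝ} (h : IsChart G ξ dξ ρ)
    (F : ℝ[X]) (h0 : 0 < r) (hr : r < ρ) :
    Continuous fun θ => F.eval (ξ (r * Real.cos θ)) * Real.cos θ :=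
  (continuous_comp_mul_cos (h.continuousOn_eval F) h0 hr).mul Real.continuous_cos

lemma IsChart.melnikov_add_smul {G : ℝ[X]} {ξ dξ : ℝ → ℝ} {ρ r : ℝ} (h : IsChart G ξ dξ ρ)
    (F P : ℝ[X]) (c : ℝ) (h0 : 0 < r) (hr : r < ρ) :
    melnikov ξ (F + C c * P) r = melnikov ξ F r + c * melnikov ξ P r := by
  simp only [melnikov]
  rw [← intervalIntegral.integral_const_mul, ← intervalIntegral.integral_add]
  · refine intervalIntegral.integral_congr fun θ _ => ?_
    simp only [eval_add, eval_mul, eval_C]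
    ring
  · exact (h.continuous_integrand F h0 hr).intervalIntegrable _ _
  · exact ((h.continuous_integrand P h0 hr).const_smul c).intervalIntegrable _ _

lemma IsChart.hasDerivAt_melnikov {G : ℝ[X]} {ξ dξ : ℝ → ℝ} {ρ r : ℝ} (h : IsChart G ξ dξ ρ)
    (F : ℝ[X]) (h0 : 0 < r) (hr : r < ρ) :
    HasDerivAt (melnikov ξ F) (∫ θ in (0:ℝ)..(2 * Real.pi),
      F.derivative.eval (ξ (r * Real.cos θ)) * dξ (r * Real.cos θ) * Real.cos θ ^ 2) r := by
  obtain ⟨b, hrb, hb⟩ := exists_between hr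
  have hdc : ContinuousOn (fun s => F.derivative.eval (ξ s) * dξ s) (Ioo (-ρ) ρ) :=
    (h.continuousOn_eval F.derivative).mul h.cont
  obtain ⟨C, hC⟩ : ∃ C, ∀ s ∈ Icc (-b) b, ‖F.derivative.eval (ξ s) * dξ s‖ ≤ C :=
    isCompact_Icc.exists_bound_of_continuousOn
      (hdc.mono fun s hs => ⟨by linarith [hs.1], by linarith [hs.2]⟩)
  have hnhds : Ioo 0 b ∈ 𝓝 r := isOpen_Ioo.mem_nhds ⟨h0, hrb⟩
  refine (intervalIntegral.hasDerivAt_integral_of_dominated_loc_of_deriv_le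
    (bound := fun _ => C) (F := fun r θ => F.eval (ξ (r * Real.cos θ)) * Real.cos θ)
    (F' := fun r θ => F.derivative.eval (ξ (r * Real.cos θ)) * dξ (r * Real.cos θ) *
      Real.cos θ ^ 2) hnhds ?_ ?_ ?_ ?_ ?_ ?_).2
  · filter_upwards [hnhds] with x hx
    exact (h.continuous_integrand F hx.1 (hx.2.trans hb)).aestronglyMeasurable
  · exact (h.continuous_integrand F h0 hr).intervalIntegrable _ _
  · exact ((continuous_comp_mul_cos hdc h0 hr).mul (Real.continuous_cos.pow 2)).aestronglyMeasurable
  · refine Eventually.of_forall fun θ _ x hx => ?_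
    have h1 := mul_cos_mem_Ioo hx.1 hx.2 θ
    have h2 := hC _ ⟨h1.1.le, h1.2.le⟩
    rw [norm_mul]
    have h3 : ‖Real.cos θ ^ 2‖ ≤ 1 := by
      rw [norm_pow]
      exact pow_le_one₀ (norm_nonneg _) (Real.abs_cos_le_one θ)
    calc _ ≤ C * 1 := mul_le_mul h2 h3 (norm_nonneg _) ((norm_nonneg _).trans h2)
      _ = C := mul_one C
  · exact intervalIntegrable_const
  · refine Eventually.of_forall fun θ _ x hx => ?_
    refine (((h.hasDerivAt_eval F (mul_cos_mem_Ioo hx.1 (hx.2.trans hb) θ)).comp x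
      (hasDerivAt_mul_const (Real.cos θ))).mul_const (Real.cos θ)).congr_deriv ?_
    ring

lemma integral_mul_cos_pos {f : ℝ → ℝ} {r ρ : ℝ} (h0 : 0 < r) (hr : r < ρ)
    (hf : ContinuousOn f (Ioo (-ρ) ρ)) (hmono : StrictMonoOn f (Ioo (-ρ) ρ)) :
    0 < ∫ θ in (0:ℝ)..(2 * Real.pi), f (r * Real.cos θ) * Real.cos θ := by
  have hmem := mul_cos_mem_Ioo h0 hr
  have h00 : (0:ℝ) ∈ Ioo (-ρ) ρ := ⟨by linarith, by linarith⟩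
  have hc : Continuous fun θ => f (r * Real.cos θ) :=
    hf.comp_continuous (continuous_const.mul Real.continuous_cos) hmem
  have heq : ∫ θ in (0:ℝ)..(2 * Real.pi), f (r * Real.cos θ) * Real.cos θ =
      ∫ θ in (0:ℝ)..(2 * Real.pi), (f (r * Real.cos θ) - f 0) * Real.cos θ := by
    simp only [sub_mul]
    rw [intervalIntegral.integral_sub, intervalIntegral.integral_const_mul]
    rotate_left
    · exact (hc.mul Real.continuous_cos).intervalIntegrable _ _
    · exact (continuous_const.mul Real.continuous_cos).intervalIntegrable _ _
    simp
  rw [heq]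
  refine intervalIntegral.integral_pos (by positivity)
    ((hc.sub continuous_const).mul Real.continuous_cos).continuousOn (fun θ _ => ?_)
    ⟨0, ⟨le_rfl, by positivity⟩, ?_⟩
  · rcases le_total 0 (Real.cos θ) with h | h
    · exact mul_nonneg (sub_nonneg.2 (hmono.monotoneOn h00 (hmem θ) (by positivity))) h
    · refine mul_nonneg_of_nonpos_of_nonpos (sub_nonpos.2 (hmono.monotoneOn (hmem θ) h00 ?_)) h
      exact mul_nonpos_of_nonneg_of_nonpos h0.le h
  · rw [Real.cos_zero, mul_one, mul_one]
    exact sub_pos.2 (hmono h00 ⟨by linarith, hr⟩ h0)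

lemma IsChart.melnikov_X_pos {G : ℝ[X]} {ξ dξ : ℝ → ℝ} {ρ r : ℝ} (h : IsChart G ξ dξ ρ)
    (h0 : 0 < r) (hr : r < ρ) : 0 < melnikov ξ X r := by
  simp only [melnikov, eval_X]
  exact integral_mul_cos_pos h0 hr h.continuousOn h.strictMonoOn

/-- A chart of `G` together with an annulus on which the Melnikov integral of `F` changes sign. -/
structure Annulus (G F : ℝ[X]) where
  (ξ dξ : ℝ → ℝ)
  (ρ a b : ℝ)
  chart : IsChart G ξ dξ ρ
  a_pos : 0 < a
  a_lt_b : a < b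
  b_lt : b < ρ
  sign : melnikov ξ F a * melnikov ξ F b < 0

/-- The set of abscissas swept by the annulus. -/
def Annulus.region {G F : ℝ[X]} (A : Annulus G F) : Set ℝ := A.ξ '' {s | A.a < |s| ∧ |s| < A.b}

lemma Annulus.sign_eventually {G F : ℝ[X]} (A : Annulus G F) (P : ℝ[X]) :
    ∀ᶠ c : ℝ in 𝓝 0, melnikov A.ξ (F + C c * P) A.a * melnikov A.ξ (F + C c * P) A.b < 0 := by
  have ha : A.a < A.ρ := A.a_lt_b.trans A.b_lt
  have hb : 0 < A.b := A.a_pos.trans A.a_lt_b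
  simp only [A.chart.melnikov_add_smul F P _ A.a_pos ha, A.chart.melnikov_add_smul F P _ hb A.b_lt]
  have hc : Continuous fun c : ℝ => (melnikov A.ξ F A.a + c * melnikov A.ξ P A.a) *
      (melnikov A.ξ F A.b + c * melnikov A.ξ P A.b) := by fun_prop
  refine hc.continuousAt.eventually_lt continuousAt_const ?_
  simpa using A.sign

lemma Annulus.exists_null {G F : ℝ[X]} (A : Annulus G F) :
    ∃ N : Set ℝ, MeasureTheory.volume N = 0 ∧ ∀ c ∉ N,
      melnikov A.ξ (F + C c * X) A.a * melnikov A.ξ (F + C c * X) A.b < 0 →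
      ∃ r, A.a < r ∧ r < A.b ∧ melnikov A.ξ (F + C c * X) r = 0 ∧
        ∫ θ in (0:ℝ)..(2 * Real.pi), (F + C c * X).derivative.eval (A.ξ (r * Real.cos θ)) *
          A.dξ (r * Real.cos θ) * Real.cos θ ^ 2 ≠ 0 := by
  have hb : 0 < A.b := A.a_pos.trans A.a_lt_b
  have hX : ∀ r ∈ Ioo 0 A.ρ, 0 < melnikov A.ξ X r := fun r hr => A.chart.melnikov_X_pos hr.1 hr.2
  choose! dF hdF using fun r (hr : r ∈ Ioo 0 A.ρ) =>
    (⟨_, A.chart.hasDerivAt_melnikov F hr.1 hr.2⟩ : ∃ d, HasDerivAt (melnikov A.ξ F) d r)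
  choose! dX hdX using fun r (hr : r ∈ Ioo 0 A.ρ) =>
    (⟨_, A.chart.hasDerivAt_melnikov X hr.1 hr.2⟩ : ∃ d, HasDerivAt (melnikov A.ξ X) d r)
  set Q : ℝ → ℝ := fun r => -(melnikov A.ξ F r / melnikov A.ξ X r) with hQ
  set dQ : ℝ → ℝ := fun r => -((dF r * melnikov A.ξ X r - melnikov A.ξ F r * dX r) /
    melnikov A.ξ X r ^ 2) with hdQ
  have hQd : ∀ r ∈ Ioo 0 A.ρ, HasDerivAt Q (dQ r) r := fun r hr =>
    ((hdF r hr).div (hdX r hr) (hX r hr).ne').neg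
  refine ⟨Q '' {r ∈ Ioo 0 A.ρ | dQ r = 0}, ?_, fun c hc hs => ?_⟩
  · refine MeasureTheory.addHaar_image_eq_zero_of_det_fderivWithin_eq_zero MeasureTheory.volume
      (f' := fun r => ContinuousLinearMap.toSpanSingleton ℝ (dQ r))
      (fun r hr => (hQd r hr.1).hasFDerivAt.hasFDerivWithinAt) fun r hr => ?_
    rw [hr.2]
    simp
  · have hd : ∀ r ∈ Ioo 0 A.ρ, HasDerivAt (melnikov A.ξ (F + C c * X))
        (∫ θ in (0:ℝ)..(2 * Real.pi), (F + C c * X).derivative.eval (A.ξ (r * Real.cos θ)) *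
          A.dξ (r * Real.cos θ) * Real.cos θ ^ 2) r := fun r hr =>
      A.chart.hasDerivAt_melnikov _ hr.1 hr.2
    have hcont : ContinuousOn (melnikov A.ξ (F + C c * X)) (Icc A.a A.b) := fun r hr =>
      (hd r ⟨A.a_pos.trans_le hr.1, hr.2.trans_lt A.b_lt⟩).continuousAt.continuousWithinAt
    obtain ⟨r, hr, hr0⟩ : ∃ r ∈ Ioo A.a A.b, melnikov A.ξ (F + C c * X) r = 0 := by
      rcases mul_neg_iff.1 hs with ⟨h1, h2⟩ | ⟨h1, h2⟩
      · exact intermediate_value_Ioo' A.a_lt_b.le hcont ⟨h2, h1⟩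
      · exact intermediate_value_Ioo A.a_lt_b.le hcont ⟨h1, h2⟩
    refine ⟨r, hr.1, hr.2, hr0, fun h0 => hc ⟨r, ⟨?_, ?_⟩, ?_⟩⟩
    · exact ⟨A.a_pos.trans hr.1, hr.2.trans A.b_lt⟩
    all_goals
      have hm : r ∈ Ioo 0 A.ρ := ⟨A.a_pos.trans hr.1, hr.2.trans A.b_lt⟩
      have hXr := (hX r hm).ne'
      rw [A.chart.melnikov_add_smul F X c hm.1 hm.2] at hr0
    · have h1 : HasDerivAt (melnikov A.ξ (F + C c * X)) (dF r + c * dX r) r := by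
        refine ((hdF r hm).add ((hdX r hm).const_mul c)).congr_of_eventuallyEq ?_
        filter_upwards [isOpen_Ioo.mem_nhds hm] with x hx
        exact A.chart.melnikov_add_smul F X c hx.1 hx.2
      have h2 := h1.unique (hd r hm)
      rw [h0] at h2
      simp only [hdQ]
      rw [neg_eq_zero, div_eq_zero_iff]
      left
      linear_combination melnikov A.ξ X r * h2 - dX r * hr0
    · simp only [hQ]
      rw [neg_eq_iff_eq_neg, div_eq_iff hXr]
      linear_combination hr0

theorem exists_limitCycles_of_annuli {ι : Type} [Fintype ι] {G F : ℝ[X]} (A : ι → Annulus G F)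
    (hA : Pairwise (Function.onFun Disjoint fun i => (A i).region)) :
    ∃ c : ℝ, ∃ ε₀ : ℝ, 0 < ε₀ ∧ ∀ ε : ℝ, 0 < ε → ε ≤ ε₀ →
      ∃ S : Finset (Set (ℝ × ℝ)),
        (∀ Γ ∈ S, IsLimitCycle (lienard (F + C c * X).derivative G.derivative ε) Γ) ∧
        S.card = Fintype.card ι := by
  classical
  choose N hN hNc using fun i => (A i).exists_null
  obtain ⟨d, hd, hdc⟩ := Metric.eventually_nhds_iff.1
    (eventually_all.2 fun i => (A i).sign_eventually X)
  obtain ⟨c, hcd, hcN⟩ : ∃ c ∈ Ioo (-d) d, c ∉ ⋃ i, N i := by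
    by_contra! hcon
    have h1 : MeasureTheory.volume (Ioo (-d) d) = 0 :=
      MeasureTheory.measure_mono_null hcon (MeasureTheory.measure_iUnion_null hN)
    rw [Real.volume_Ioo, ENNReal.ofReal_eq_zero] at h1
    linarith
  have hs := hdc (y := c) (by rw [Real.dist_eq, sub_zero]; exact abs_lt.2 hcd)
  simp only [mem_iUnion, not_exists] at hcN
  choose r har hrb hr0 hr1 using fun i => hNc i c (hcN i) (hs i)
  choose e he H using fun i => exists_limitCycle (A i).chart (A i).a_pos (har i) (hrb i) (A i).b_lt
    (hr0 i) (hr1 i)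
  obtain ⟨ε₀, hε₀, hε₀0⟩ : ∃ ε₀, (∀ i, ε₀ ≤ e i) ∧ 0 < ε₀ := by
    have h1 : ∀ᶠ x in 𝓝[>] (0:ℝ), ∀ i, x ≤ e i := eventually_all.2 fun i =>
      nhdsWithin_le_nhds (Iic_mem_nhds (he i))
    exact (h1.and self_mem_nhdsWithin).exists
  refine ⟨c, ε₀, hε₀0, fun ε hε hεε => ?_⟩
  choose Γ hΓ hΓ1 hΓ2 using fun i => H i ε hε (hεε.trans (hε₀ i))
  refine ⟨Finset.univ.image Γ, fun Γ' h => ?_, ?_⟩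
  · obtain ⟨i, -, rfl⟩ := Finset.mem_image.1 h
    exact hΓ i
  · rw [Finset.card_image_of_injective, Finset.card_univ]
    intro i j hij
    by_contra hne
    obtain ⟨p, hp, hp0⟩ := hΓ1 i
    exact Set.disjoint_left.1 (hA hne) (hΓ2 i p hp hp0) (hΓ2 j p (hij ▸ hp) hp0)

end Melnikov

section Pullback
open Set Topology

lemma integral_comp_neg_cos (f : ℝ → ℝ) (r : ℝ) :
    ∫ θ in (0:ℝ)..(2 * Real.pi), f (-(r * Real.cos θ)) * Real.cos θ =
      -∫ θ in (0:ℝ)..(2 * Real.pi), f (r * Real.cos θ) * Real.cos θ := by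
  have hp : Function.Periodic (fun θ => f (r * Real.cos θ) * Real.cos θ) (2 * Real.pi) :=
    fun θ => by simp only [Real.cos_add_two_pi]
  have h1 := hp.intervalIntegral_add_eq Real.pi 0
  rw [zero_add] at h1
  rw [← h1, ← intervalIntegral.integral_neg, add_comm Real.pi]
  have h2 := intervalIntegral.integral_comp_add_right (a := 0) (b := 2 * Real.pi)
    (fun θ => -(f (r * Real.cos θ) * Real.cos θ)) Real.pi
  rw [zero_add] at h2
  rw [← h2]
  refine intervalIntegral.integral_congr fun θ _ => ?_
  simp only [Real.cos_add_pi, mul_neg, neg_neg]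

lemma derivative_comp_sq_sub (G : ℝ[X]) (c x : ℝ) :
    (G.comp (X ^ 2 - C c)).derivative.eval x = 2 * x * G.derivative.eval (x ^ 2 - c) := by
  have h : derivative (X ^ 2 - C c) = C 2 * X := by simp [← one_add_one_eq_two]
  rw [derivative_comp, h]
  simp only [eval_mul, eval_comp, eval_C, eval_X, eval_sub, eval_pow]

lemma Annulus.pullback {G F : ℝ[X]} (A : Annulus G F) : ∀ᶠ c : ℝ in atTop,
    ∃ A₁ A₂ : Annulus (G.comp (X ^ 2 - C c)) (F.comp (X ^ 2 - C c)),
      (∀ x ∈ A₁.region, 1 < x ∧ x ^ 2 - c ∈ A.region) ∧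
      (∀ x ∈ A₂.region, x < -1 ∧ x ^ 2 - c ∈ A.region) := by
  obtain ⟨ρ, hbρ, hρ⟩ := exists_between A.b_lt
  have ha0 := A.a_pos
  have hb0 : 0 < A.b := A.a_pos.trans A.a_lt_b
  have hab := A.a_lt_b
  have hsub : ∀ s ∈ Ioo (-ρ) ρ, s ∈ Ioo (-A.ρ) A.ρ := fun s hs =>
    ⟨by linarith [hs.1], by linarith [hs.2]⟩
  obtain ⟨M, hM⟩ : ∃ M, ∀ s ∈ Icc (-ρ) ρ, ‖A.ξ s‖ ≤ M :=
    isCompact_Icc.exists_bound_of_continuousOn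
      (A.chart.continuousOn.mono fun s hs => ⟨by linarith [hs.1], by linarith [hs.2]⟩)
  filter_upwards [eventually_gt_atTop (M + 1)] with c hc
  have hpos : ∀ s ∈ Ioo (-ρ) ρ, 1 < A.ξ s + c := fun s hs => by
    have := neg_le_of_abs_le (hM s ⟨hs.1.le, hs.2.le⟩)
    linarith
  set X₁ : ℝ → ℝ := fun s => √(A.ξ s + c) with hX₁
  set D₁ : ℝ → ℝ := fun s => A.dξ s / (2 * √(A.ξ s + c)) with hD₁
  have hX1 : ∀ s ∈ Ioo (-ρ) ρ, 1 < X₁ s := fun s hs => by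
    rw [hX₁]; exact Real.lt_sqrt_of_sq_lt (by linarith [hpos s hs])
  have hsq : ∀ s ∈ Ioo (-ρ) ρ, X₁ s ^ 2 = A.ξ s + c := fun s hs =>
    Real.sq_sqrt (by linarith [hpos s hs])
  have hneg : ∀ s ∈ Ioo (-ρ) ρ, -s ∈ Ioo (-ρ) ρ := fun s hs =>
    ⟨by linarith [hs.2], by linarith [hs.1]⟩
  have hch₁ : IsChart (G.comp (X ^ 2 - C c)) X₁ D₁ ρ := by
    refine ⟨by linarith, fun s hs => ?_, ?_, fun s hs => ?_, fun s hs => ?_⟩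
    · exact ((A.chart.hasDerivAt s (hsub s hs)).add_const c).sqrt (by linarith [hpos s hs])
    · refine (A.chart.cont.mono hsub).div (continuousOn_const.mul
        ((A.chart.continuousOn.mono hsub).add continuousOn_const).sqrt) fun s hs => ?_
      have : 1 < √(A.ξ s + c) := hX1 s hs
      positivity
    · have : 1 < √(A.ξ s + c) := hX1 s hs
      exact div_pos (A.chart.dpos s (hsub s hs)) (by positivity)
    · have h1 := hX1 s hs
      rw [derivative_comp_sq_sub, hsq s hs, add_sub_cancel_right]
      change _ * (A.dξ s / (2 * X₁ s)) = s
      rw [mul_div_assoc', div_eq_iff (by positivity)]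
      linear_combination (2 * X₁ s) * A.chart.eq s (hsub s hs)
  have hch₂ : IsChart (G.comp (X ^ 2 - C c)) (fun s => -X₁ (-s)) (fun s => D₁ (-s)) ρ := by
    refine ⟨by linarith, fun s hs => ?_, ?_, fun s hs => ?_, fun s hs => ?_⟩
    · refine ((hch₁.hasDerivAt (-s) (hneg s hs)).scomp s (hasDerivAt_neg s)).neg.congr_deriv ?_
      simp
    · exact hch₁.cont.comp continuous_neg.continuousOn hneg
    · exact hch₁.dpos _ (hneg s hs)
    · have := hch₁.eq _ (hneg s hs)
      rw [derivative_comp_sq_sub] at this ⊢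
      rw [neg_sq]
      linear_combination -this
  have hF : ∀ s ∈ Ioo (-ρ) ρ, (F.comp (X ^ 2 - C c)).eval (X₁ s) = F.eval (A.ξ s) :=
    fun s hs => by simp [eval_comp, hsq s hs]
  have hm₁ : ∀ r, 0 < r → r < ρ →
      melnikov X₁ (F.comp (X ^ 2 - C c)) r = melnikov A.ξ F r := fun r h0 hr =>
    intervalIntegral.integral_congr fun θ _ => by simp only [hF _ (mul_cos_mem_Ioo h0 hr θ)]
  have hm₂ : ∀ r, 0 < r → r < ρ →
      melnikov (fun s => -X₁ (-s)) (F.comp (X ^ 2 - C c)) r = -melnikov A.ξ F r := by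
    intro r h0 hr
    rw [← hm₁ r h0 hr, melnikov, melnikov,
      ← integral_comp_neg_cos (fun s => (F.comp (X ^ 2 - C c)).eval (X₁ s))]
    refine intervalIntegral.integral_congr fun θ _ => ?_
    simp [eval_comp]
  refine ⟨⟨X₁, D₁, ρ, A.a, A.b, hch₁, ha0, hab, hbρ, ?_⟩,
    ⟨_, _, ρ, A.a, A.b, hch₂, ha0, hab, hbρ, ?_⟩, ?_, ?_⟩
  · rw [hm₁ _ ha0 (by linarith), hm₁ _ hb0 hbρ]
    exact A.sign
  · rw [hm₂ _ ha0 (by linarith), hm₂ _ hb0 hbρ, neg_mul_neg]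
    exact A.sign
  · rintro _ ⟨s, hs, rfl⟩
    have hm : s ∈ Ioo (-ρ) ρ := abs_lt.1 (hs.2.trans hbρ)
    refine ⟨hX1 s hm, s, hs, ?_⟩
    change A.ξ s = X₁ s ^ 2 - c
    rw [hsq s hm]; ring
  · rintro _ ⟨s, hs, rfl⟩
    have hm : -s ∈ Ioo (-ρ) ρ := hneg s (abs_lt.1 (hs.2.trans hbρ))
    refine ⟨neg_lt_neg (hX1 _ hm), -s, by simpa using hs, ?_⟩
    change A.ξ (-s) = (-X₁ (-s)) ^ 2 - c
    rw [neg_sq, hsq _ hm]; ring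

end Pullback

section Center
open Set Topology

lemma hasDerivAt_eval_comp (B : ℝ[X]) {f : ℝ → ℝ} {f' x : ℝ} (hf : HasDerivAt f f' x) :
    HasDerivAt (fun x => B.eval (f x)) (B.derivative.eval (f x) * f') x :=
  (B.hasDerivAt (f x)).comp x hf

lemma exists_chart {G B : ℝ[X]} {k : ℝ} (hG : ∀ x, G.eval x = B.eval x * x ^ 2 + k)
    (hB0 : 0 < B.eval 0) :
    ∃ (ξ dξ : ℝ → ℝ) (ρ : ℝ), IsChart G ξ dξ ρ ∧ ξ 0 = 0 ∧ (∀ s ∈ Ioo (-ρ) ρ, |ξ s| < 1) ∧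
      ((∀ x, B.eval (-x) = B.eval x) → ∀ s ∈ Ioo (-ρ) ρ, ξ (-s) = -ξ s) := by
  set σ : ℝ → ℝ := fun x => x * √(2 * B.eval x) with hσ
  set dσ : ℝ → ℝ := fun x => √(2 * B.eval x) +
    x * (2 * B.derivative.eval x / (2 * √(2 * B.eval x))) with hdσ
  have hBc : Continuous fun x : ℝ => √(2 * B.eval x) :=
    (continuous_const.mul B.continuous).sqrt
  have hnear : ∀ᶠ x in 𝓝 (0:ℝ), 0 < B.eval x ∧ 0 < dσ x := by
    refine Eventually.and ?_ ?_
    · refine continuousAt_const.eventually_lt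
        B.continuous.continuousAt ?_
      simpa using hB0
    · refine continuousAt_const.eventually_lt (hBc.continuousAt.add (continuousAt_id.mul
        (ContinuousAt.div (by fun_prop) (continuousAt_const.mul hBc.continuousAt) ?_))) ?_
      · have : 0 < √(2 * B.eval (0:ℝ)) := Real.sqrt_pos.2 (by simpa using hB0)
        positivity
      · have : 0 < √(2 * B.eval (0:ℝ)) := Real.sqrt_pos.2 (by simpa using hB0)
        simpa [hdσ] using this
  obtain ⟨δ₀, hδ₀, hball⟩ := Metric.eventually_nhds_iff.1 hnear
  obtain ⟨δ, hδ0, hδ⟩ := exists_between (lt_min hδ₀ one_pos)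
  have hin : ∀ x ∈ Icc (-δ) δ, 0 < B.eval x ∧ 0 < dσ x := fun x hx => by
    refine hball ?_
    rw [Real.dist_eq, sub_zero]
    exact (abs_le.2 hx).trans_lt (hδ.trans_le (min_le_left _ _))
  have hin' : ∀ x ∈ Ioo (-δ) δ, 0 < B.eval x ∧ 0 < dσ x := fun x hx => hin x ⟨hx.1.le, hx.2.le⟩
  have hσd : ∀ x ∈ Ioo (-δ) δ, HasDerivAt σ (dσ x) x := fun x hx => by
    have h1 : HasDerivAt (fun x => 2 * B.eval x) (2 * B.derivative.eval x) x :=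
      (B.hasDerivAt x).const_mul 2
    have h2 := h1.sqrt (by have := (hin' x hx).1; positivity)
    exact ((hasDerivAt_id' x).mul h2).congr_deriv (by rw [one_mul])
  have hdσc : ContinuousOn dσ (Ioo (-δ) δ) := by
    refine hBc.continuousOn.add (continuousOn_id.mul
      (ContinuousOn.div (by fun_prop) (continuousOn_const.mul hBc.continuousOn) fun x hx => ?_))
    have : 0 < √(2 * B.eval x) := Real.sqrt_pos.2 (by have := (hin' x hx).1; positivity)
    positivity
  obtain ⟨-, -, ξ, hξ, hξd⟩ := exists_inverse_of_deriv_pos hσd hdσc fun x hx => (hin' x hx).2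
  have hσc : Continuous σ := continuous_id.mul hBc
  have hσδ : 0 < σ δ := mul_pos hδ0 (Real.sqrt_pos.2 (by
    have := (hin δ ⟨by linarith, le_rfl⟩).1; positivity))
  have hσδ' : 0 < -σ (-δ) := by
    rw [← neg_mul, neg_neg]
    exact mul_pos hδ0 (Real.sqrt_pos.2 (by
      have := (hin (-δ) ⟨le_rfl, by linarith⟩).1; positivity))
  set ρ := min (σ δ) (-σ (-δ)) with hρdef
  have hρ : 0 < ρ := lt_min hσδ hσδ'
  have himg : ∀ s ∈ Ioo (-ρ) ρ, ξ s ∈ Ioo (-δ) δ ∧ σ (ξ s) = s := fun s hs => by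
    have hs' : s ∈ Ioo (σ (-δ)) (σ δ) :=
      ⟨by linarith [hs.1, min_le_right (σ δ) (-σ (-δ))], hs.2.trans_le (min_le_left _ _)⟩
    obtain ⟨x, hx, rfl⟩ := intermediate_value_Ioo (by linarith) hσc.continuousOn hs'
    rw [hξ x hx]
    exact ⟨hx, rfl⟩
  have hξd' : ∀ s ∈ Ioo (-ρ) ρ, HasDerivAt ξ (dσ (ξ s))⁻¹ s := fun s hs => by
    have := hξd (ξ s) (himg s hs).1
    rwa [(himg s hs).2] at this
  refine ⟨ξ, fun s => (dσ (ξ s))⁻¹, ρ, ⟨hρ, hξd', ?_, ?_, fun s hs => ?_⟩, ?_, fun s hs => ?_,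
    fun hBe s hs => ?_⟩
  · refine ContinuousOn.inv₀ (hdσc.comp (fun s hs => (hξd' s hs).continuousAt.continuousWithinAt)
      fun s hs => (himg s hs).1) fun s hs => (hin' _ (himg s hs).1).2.ne'
  · exact fun s hs => inv_pos.2 (hin' _ (himg s hs).1).2
  · obtain ⟨hx, he⟩ := himg s hs
    set x := ξ s
    have h1 : HasDerivAt (fun x => (G).eval x)
        ((G).derivative.eval x) x := Polynomial.hasDerivAt _ _
    have h2 : HasDerivAt (fun x => (G).eval x) (σ x * dσ x) x := by
      refine ((((hσd x hx).pow 2).div_const 2).add_const k).congr_of_eventuallyEq ?_ |>.congr_deriv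
        (by simp; ring)
      filter_upwards [isOpen_Ioo.mem_nhds hx] with y hy
      have h3 : √(2 * B.eval y) ^ 2 = 2 * B.eval y :=
        Real.sq_sqrt (by have := (hin' y hy).1; positivity)
      simp only [hG, hσ, Pi.pow_apply, mul_pow, h3]
      ring
    rw [h1.unique h2, mul_assoc, mul_inv_cancel₀ (hin' x hx).2.ne', mul_one, he]
  · have := hξ 0 ⟨by linarith, hδ0⟩
    simpa [hσ] using this
  · exact (abs_lt.2 (himg s hs).1).trans (hδ.trans_le (min_le_right _ _))
  · obtain ⟨hx, he⟩ := himg s hs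
    have hx' : -ξ s ∈ Ioo (-δ) δ := ⟨by linarith [hx.2], by linarith [hx.1]⟩
    have hσodd : σ (-ξ s) = -σ (ξ s) := by simp [hσ, hBe]
    have := hξ _ hx'
    rwa [hσodd, he] at this

lemma exists_odd_chart {G : ℝ[X]} {c : ℝ} (hG : 0 < G.derivative.eval (-c)) :
    ∃ (ξ dξ : ℝ → ℝ) (ρ : ℝ), IsChart (G.comp (X ^ 2 - C c)) ξ dξ ρ ∧ ξ 0 = 0 ∧
      (∀ s ∈ Ioo (-ρ) ρ, |ξ s| < 1) ∧ ∀ s ∈ Ioo (-ρ) ρ, ξ (-s) = -ξ s := by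
  set B : ℝ[X] := (G.comp (X - C c)).divX with hB
  set k : ℝ := (G.comp (X - C c)).coeff 0 with hk
  have hGB : ∀ y, G.eval (y - c) = B.eval y * y + k := fun y => by
    have := congrArg (eval y) (divX_mul_X_add (G.comp (X - C c)))
    simpa [eval_comp] using this.symm
  have hB0 : 0 < B.eval 0 := by
    have h1 : HasDerivAt (fun y => G.eval (y - c)) (G.derivative.eval (0 - c)) 0 :=
      (hasDerivAt_eval_comp G ((hasDerivAt_id' 0).sub_const c)).congr_deriv (mul_one _)
    have h2 : HasDerivAt (fun y => G.eval (y - c)) (B.derivative.eval 0 * 0 + B.eval 0 * 1) 0 := by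
      simp only [hGB]
      exact ((B.hasDerivAt 0).mul (hasDerivAt_id' 0)).add_const k
    have h3 := h1.unique h2
    rw [zero_sub, mul_zero, zero_add, mul_one] at h3
    rwa [← h3]
  have hGB2 : ∀ x, (G.comp (X ^ 2 - C c)).eval x = (B.comp (X ^ 2)).eval x * x ^ 2 + k :=
    fun x => by simp only [eval_comp, eval_sub, eval_pow, eval_X, eval_C, hGB]
  obtain ⟨ξ, dξ, ρ, h, h0, h1, hodd⟩ := exists_chart hGB2 (by simpa [eval_comp] using hB0)
  exact ⟨ξ, dξ, ρ, h, h0, h1, hodd fun x => by simp [eval_comp]⟩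

end Center

section Alternating
open Set Topology

lemma IsChart.melnikov_X_pow_pos {G : ℝ[X]} {ξ dξ : ℝ → ℝ} {ρ r : ℝ} (h : IsChart G ξ dξ ρ)
    (j : ℕ) (h0 : 0 < r) (hr : r < ρ) : 0 < melnikov ξ (X ^ (2 * j + 1)) r := by
  simp only [melnikov, eval_pow, eval_X]
  exact integral_mul_cos_pos h0 hr (h.continuousOn.pow _)
    fun x hx y hy hxy => (Odd.strictMono_pow ⟨j, rfl⟩) (h.strictMonoOn hx hy hxy)

lemma IsChart.melnikov_X_pow_le {G : ℝ[X]} {ξ dξ : ℝ → ℝ} {ρ r η : ℝ} (h : IsChart G ξ dξ ρ)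
    (hξ0 : ξ 0 = 0) (j : ℕ) (h0 : 0 < r) (hr : r < ρ) (hη : ∀ s, |s| ≤ r → |ξ s| ≤ η) :
    melnikov ξ (X ^ (2 * (j + 1) + 1)) r ≤ η ^ 2 * melnikov ξ (X ^ (2 * j + 1)) r := by
  have hm := mul_cos_mem_Ioo h0 hr
  have h00 : (0:ℝ) ∈ Ioo (-ρ) ρ := ⟨by linarith, by linarith⟩
  rw [melnikov, melnikov, ← intervalIntegral.integral_const_mul]
  refine intervalIntegral.integral_mono_on (by positivity)
    ((h.continuous_integrand _ h0 hr).intervalIntegrable _ _)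
    (((h.continuous_integrand _ h0 hr).const_smul (η ^ 2)).intervalIntegrable _ _) fun θ _ => ?_
  simp only [eval_pow, eval_X]
  have h1 : ξ (r * Real.cos θ) ^ 2 ≤ η ^ 2 := by
    refine sq_le_sq.2 ((hη _ ?_).trans (le_abs_self η))
    rw [abs_mul, abs_of_pos h0]
    exact mul_le_of_le_one_right h0.le (Real.abs_cos_le_one θ)
  have h2 : 0 ≤ ξ (r * Real.cos θ) ^ (2 * j + 1) * Real.cos θ := by
    have h3 : ξ (r * Real.cos θ) ^ (2 * j + 1) * Real.cos θ =
        (ξ (r * Real.cos θ) ^ 2) ^ j * (ξ (r * Real.cos θ) * Real.cos θ) := by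
      rw [pow_succ, pow_mul]; ring
    rw [h3]
    refine mul_nonneg (by positivity) ?_
    rcases le_total 0 (Real.cos θ) with hc | hc
    · refine mul_nonneg ?_ hc
      rw [← hξ0]
      exact h.strictMonoOn.monotoneOn h00 (hm θ) (by positivity)
    · refine mul_nonneg_of_nonpos_of_nonpos ?_ hc
      rw [← hξ0]
      exact h.strictMonoOn.monotoneOn (hm θ) h00 (mul_nonpos_of_nonneg_of_nonpos h0.le hc)
  calc _ = ξ (r * Real.cos θ) ^ 2 * (ξ (r * Real.cos θ) ^ (2 * j + 1) * Real.cos θ) := by ring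
    _ ≤ _ := mul_le_mul_of_nonneg_right h1 h2

lemma IsChart.exists_alternating {G : ℝ[X]} {ξ dξ : ℝ → ℝ} {ρ : ℝ} (h : IsChart G ξ dξ ρ)
    (hξ0 : ξ 0 = 0) (hone : ∀ s ∈ Ioo (-ρ) ρ, |ξ s| < 1) (n : ℕ) :
    ∀ j : ℕ, ∃ (P : ℝ[X]) (K : ℝ) (r : ℕ → ℝ),
      P.natDegree ≤ 2 * (j + n) + 1 ∧
      (∀ x, 0 < x → x < ρ → |melnikov ξ P x| ≤ K * melnikov ξ (X ^ (2 * j + 1)) x) ∧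
      (∀ l ≤ n, 0 < r l ∧ r l < ρ) ∧ (∀ l < n, r (l + 1) < r l) ∧
      (∀ l < n, melnikov ξ P (r l) * melnikov ξ P (r (l + 1)) < 0) ∧ melnikov ξ P (r n) ≠ 0 := by
  have hρ := h.pos
  induction n with
  | zero =>
    intro j
    refine ⟨X ^ (2 * j + 1), 1, fun _ => ρ / 2, by simp, fun x h0 hx => ?_,
      fun _ _ => ⟨by linarith, by linarith⟩, by simp, by simp,
      (h.melnikov_X_pow_pos j (by linarith) (by linarith)).ne'⟩
    rw [one_mul, abs_of_pos (h.melnikov_X_pow_pos j h0 hx)]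
  | succ n ih =>
    intro j
    obtain ⟨P, K, r, hdeg, hK, hr, hlt, hsgn, hne⟩ := ih (j + 1)
    set m := melnikov ξ P (r n) with hm
    set I := melnikov ξ (X ^ (2 * j + 1)) with hI
    have hlin : ∀ c x, 0 < x → x < ρ → melnikov ξ (P + C c * X ^ (2 * j + 1)) x =
        melnikov ξ P x + c * I x := fun c x h0 hx => h.melnikov_add_smul P _ c h0 hx
    have hev : ∀ᶠ c : ℝ in 𝓝 0, (∀ l : Fin n,
        (melnikov ξ P (r l) + c * I (r l)) * (melnikov ξ P (r (l + 1)) + c * I (r (l + 1))) < 0) ∧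
        0 < (m + c * I (r n)) * m := by
      refine (eventually_all.2 fun l => ?_).and ?_
      · have hc : Continuous fun c : ℝ => (melnikov ξ P (r l) + c * I (r l)) *
            (melnikov ξ P (r (l + 1)) + c * I (r (l + 1))) := by fun_prop
        refine hc.continuousAt.eventually_lt continuousAt_const ?_
        simpa using hsgn l l.2
      · have hc : Continuous fun c : ℝ => (m + c * I (r n)) * m := by fun_prop
        refine continuousAt_const.eventually_lt hc.continuousAt ?_
        simpa using mul_self_pos.2 hne
    have htend : Tendsto (fun t : ℝ => -t * m) (𝓝[>] 0) (𝓝 0) := by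
      have hc : Continuous fun t : ℝ => -t * m := by fun_prop
      have := hc.tendsto 0
      rw [neg_zero, zero_mul] at this
      exact this.mono_left nhdsWithin_le_nhds
    obtain ⟨t, ⟨ht1, ht2⟩, ht0⟩ := ((htend.eventually hev).and self_mem_nhdsWithin).exists
    replace ht0 : 0 < t := ht0
    set c := -t * m with hc
    have hc0 : c ≠ 0 := mul_ne_zero (neg_ne_zero.2 ht0.ne') hne
    have h00 : (0:ℝ) ∈ Ioo (-ρ) ρ := ⟨by linarith, by linarith⟩
    obtain ⟨η, hKη, hη⟩ : ∃ η, |K| * η ^ 2 < |c| ∧ 0 < η := by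
      have hcont : Continuous fun η : ℝ => |K| * η ^ 2 := by fun_prop
      have h1 : ∀ᶠ η in 𝓝[>] (0:ℝ), |K| * η ^ 2 < |c| :=
        (hcont.continuousAt.eventually_lt continuousAt_const (by simpa using hc0)).filter_mono
          nhdsWithin_le_nhds
      exact (h1.and self_mem_nhdsWithin).exists
    obtain ⟨δ, hδ, hball⟩ := Metric.continuousAt_iff.1 (h.hasDerivAt 0 h00).continuousAt η hη
    obtain ⟨x, hx0, hx⟩ := exists_between (lt_min hδ (hr n le_rfl).1)
    have hxr : x < r n := hx.trans_le (min_le_right _ _)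
    have hxρ : x < ρ := hxr.trans (hr n le_rfl).2
    have hxη : ∀ s, |s| ≤ x → |ξ s| ≤ η := fun s hs => by
      have := hball (x := s) (by
        rw [Real.dist_eq, sub_zero]
        exact hs.trans_lt (hx.trans_le (min_le_left _ _)))
      rw [hξ0, Real.dist_eq, sub_zero] at this
      exact this.le
    have hbound : ∀ y τ, 0 < y → y < ρ → (∀ s, |s| ≤ y → |ξ s| ≤ τ) →
        |melnikov ξ P y| ≤ |K| * τ ^ 2 * I y := fun y τ h0 hy hτ =>
      calc |melnikov ξ P y| ≤ K * melnikov ξ (X ^ (2 * (j + 1) + 1)) y := hK y h0 hy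
        _ ≤ |K| * melnikov ξ (X ^ (2 * (j + 1) + 1)) y :=
          mul_le_mul_of_nonneg_right (le_abs_self K) (h.melnikov_X_pow_pos _ h0 hy).le
        _ ≤ |K| * (τ ^ 2 * I y) :=
          mul_le_mul_of_nonneg_left (h.melnikov_X_pow_le hξ0 j h0 hy hτ) (abs_nonneg K)
        _ = _ := by ring
    have hIx : 0 < I x := h.melnikov_X_pow_pos j hx0 hxρ
    have hsx : 0 < (melnikov ξ P x + c * I x) * c := by
      have h1 := hbound x η hx0 hxρ hxη
      have h2 : |melnikov ξ P x * c| < c * c * I x := by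
        rw [abs_mul, ← abs_mul_abs_self c]
        calc |melnikov ξ P x| * |c| ≤ |K| * η ^ 2 * I x * |c| :=
              mul_le_mul_of_nonneg_right h1 (abs_nonneg c)
          _ < |c| * I x * |c| := by
              have := abs_pos.2 hc0
              gcongr
          _ = _ := by ring
      have := (abs_lt.1 h2).1
      linarith
    set r' : ℕ → ℝ := fun l => if l ≤ n then r l else x with hr'
    have hrl : ∀ l ≤ n, r' l = r l := fun l hl => if_pos hl
    have hrn : r' (n + 1) = x := if_neg (by omega)
    refine ⟨P + C c * X ^ (2 * j + 1), |K| + |c|, r', ?_, ?_, ?_, ?_, ?_, ?_⟩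
    · have hP : P.natDegree ≤ 2 * (j + (n + 1)) + 1 := hdeg.trans (by omega)
      have hQ : (C c * X ^ (2 * j + 1)).natDegree ≤ 2 * (j + (n + 1)) + 1 :=
        (natDegree_C_mul_X_pow_le _ _).trans (by omega)
      exact natDegree_add_le_of_degree_le hP hQ
    · intro y h0 hy
      have hIy : 0 < I y := h.melnikov_X_pow_pos j h0 hy
      have h1 := hbound y 1 h0 hy fun s hs => (hone s (abs_lt.1 (hs.trans_lt hy))).le
      rw [one_pow, mul_one] at h1
      rw [hlin c y h0 hy, add_mul]
      refine (abs_add_le _ _).trans (add_le_add h1 ?_)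
      rw [abs_mul, abs_of_pos hIy]
    · intro l hl
      rcases Nat.lt_or_eq_of_le hl with hl | rfl
      · rw [hrl l (by omega)]; exact hr l (by omega)
      · rw [hrn]; exact ⟨hx0, hxρ⟩
    · intro l hl
      rcases Nat.lt_or_eq_of_le (Nat.le_of_lt_succ hl) with hl | rfl
      · rw [hrl l hl.le, hrl (l + 1) hl]; exact hlt l hl
      · rw [hrl l le_rfl, hrn]; exact hxr
    · intro l hl
      rcases Nat.lt_or_eq_of_le (Nat.le_of_lt_succ hl) with hl | rfl
      · rw [hrl l hl.le, hrl (l + 1) hl, hlin _ _ (hr l hl.le).1 (hr l hl.le).2,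
          hlin _ _ (hr _ hl).1 (hr _ hl).2]
        exact ht1 ⟨l, hl⟩
      · rw [hrl l le_rfl, hrn, hlin _ _ hx0 hxρ, hlin _ _ (hr l le_rfl).1 (hr l le_rfl).2]
        have h3 : 0 < (melnikov ξ P x + c * I x) * (-m) := by
          have h4 : (melnikov ξ P x + c * I x) * c = t * ((melnikov ξ P x + c * I x) * (-m)) := by
            rw [hc]; ring
          rw [h4] at hsx
          exact pos_of_mul_pos_right hsx ht0.le
        have h5 : 0 < m * m := mul_self_pos.2 hne
        have h6 := mul_pos ht2 h3
        have h7 : (m + c * I (r l)) * (melnikov ξ P x + c * I x) * (m * m) < 0 := by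
          linarith
        exact neg_of_mul_neg_left h7 h5.le
    · rw [hrn, hlin _ _ hx0 hxρ]
      exact left_ne_zero_of_mul hsx.ne'

end Alternating

section Doubling
open Set Topology

/-- A pair `G, F` admits `h` annuli with pairwise disjoint regions. -/
def HasAnnuli (G F : ℝ[X]) (h : ℕ) : Prop :=
  ∃ (ι : Type) (_ : Fintype ι) (A : ι → Annulus G F), Fintype.card ι = h ∧
    Pairwise (Function.onFun Disjoint fun i => (A i).region)

lemma IsChart.exists_annuli {G : ℝ[X]} {ξ dξ : ℝ → ℝ} {ρ : ℝ} (h : IsChart G ξ dξ ρ)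
    (hξ0 : ξ 0 = 0) (hone : ∀ s ∈ Ioo (-ρ) ρ, |ξ s| < 1) (n : ℕ) :
    ∃ P : ℝ[X], P.natDegree ≤ 2 * n + 1 ∧ ∀ (F : ℝ[X]) (c : ℝ), c ≠ 0 →
      (∀ r, 0 < r → r < ρ → melnikov ξ F r = 0) →
      ∃ A : Fin n → Annulus G (F + C c * P), (∀ i, ∀ x ∈ (A i).region, |x| < 1) ∧
        Pairwise (Function.onFun Disjoint fun i => (A i).region) := by
  obtain ⟨P, -, r, hdeg, -, hr, hlt, hsgn, -⟩ := h.exists_alternating hξ0 hone n 0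
  refine ⟨P, by simpa using hdeg, fun F c hc hF => ?_⟩
  have hmel : ∀ l ≤ n, melnikov ξ (F + C c * P) (r l) = c * melnikov ξ P (r l) := fun l hl => by
    rw [h.melnikov_add_smul F P c (hr l hl).1 (hr l hl).2, hF _ (hr l hl).1 (hr l hl).2, zero_add]
  have hanti : ∀ l m, l ≤ m → m ≤ n → r m ≤ r l := fun l m hlm => by
    induction m, hlm using Nat.le_induction with
    | base => exact fun _ => le_rfl
    | succ m _ ih => exact fun hm => (hlt m hm).le.trans (ih (by omega))
  refine ⟨fun l => ⟨ξ, dξ, ρ, r (l + 1), r l, h, (hr _ l.2).1, hlt l l.2, (hr l l.2.le).2, ?_⟩,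
    ?_, ?_⟩
  · rw [hmel _ l.2, hmel _ l.2.le]
    calc c * melnikov ξ P (r (l + 1)) * (c * melnikov ξ P (r l)) =
        c * c * (melnikov ξ P (r l) * melnikov ξ P (r (l + 1))) := by ring
      _ < 0 := mul_neg_of_pos_of_neg (mul_self_pos.2 hc) (hsgn l l.2)
  · rintro i _ ⟨s, hs, rfl⟩
    exact hone s (abs_lt.1 (hs.2.trans (hr i i.2.le).2))
  · refine (pairwise_disjoint_on _).2 fun i j hij => Set.disjoint_left.2 ?_
    rintro _ ⟨s, hs, rfl⟩ ⟨t, ht, hst⟩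
    have hts : t = s := h.strictMonoOn.injOn (abs_lt.1 (ht.2.trans (hr j j.2.le).2))
      (abs_lt.1 (hs.2.trans (hr i i.2.le).2)) hst
    subst hts
    exact absurd (hs.1.trans ht.2) (hanti _ _ hij j.2.le).not_gt

lemma HasAnnuli.double {G F : ℝ[X]} {h : ℕ} (hA : HasAnnuli G F h)
    (hbot : ∀ᶠ x in atBot, 0 < G.derivative.eval x) (n : ℕ) :
    ∃ G' F' : ℝ[X], G'.natDegree ≤ 2 * G.natDegree ∧
      F'.natDegree ≤ max (2 * F.natDegree) (2 * n + 1) ∧ HasAnnuli G' F' (2 * h + n) ∧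
      ((∀ᶠ x in atTop, G.derivative.eval x < 0) → (∀ᶠ x in atBot, 0 < G'.derivative.eval x) ∧
        ∀ᶠ x in atTop, G'.derivative.eval x < 0) := by
  obtain ⟨ι, _, A, hcard, hdisj⟩ := hA
  obtain ⟨c, hpull, hc⟩ := ((eventually_all.2 fun i => (A i).pullback).and
    (tendsto_neg_atTop_atBot.eventually hbot)).exists
  set φ : ℝ[X] := X ^ 2 - C c with hφ
  choose A₁ A₂ hA₁ hA₂ using hpull
  have hdφ : φ.natDegree = 2 := natDegree_X_pow_sub_C
  obtain ⟨ξ, dξ, ρ, hch, hξ0, hone, hodd⟩ := exists_odd_chart hc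
  obtain ⟨P, hP, hcen⟩ := hch.exists_annuli hξ0 hone n
  have hzero : ∀ r, 0 < r → r < ρ → melnikov ξ (F.comp φ) r = 0 := fun r h0 hr => by
    have h1 := integral_comp_neg_cos (fun s => (F.comp φ).eval (ξ s)) r
    have h2 : ∫ θ in (0:ℝ)..(2 * Real.pi),
        (F.comp φ).eval (ξ (-(r * Real.cos θ))) * Real.cos θ = melnikov ξ (F.comp φ) r :=
      intervalIntegral.integral_congr fun θ _ => by
        simp [hodd _ (mul_cos_mem_Ioo h0 hr θ), eval_comp, hφ]
    rw [h2] at h1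
    change melnikov ξ (F.comp φ) r = -melnikov ξ (F.comp φ) r at h1
    linarith
  obtain ⟨δ, ⟨hδ₁, hδ₂⟩, hδ0⟩ := (((eventually_all.2 fun i => (A₁ i).sign_eventually P).and
    (eventually_all.2 fun i => (A₂ i).sign_eventually P)).filter_mono
      nhdsWithin_le_nhds |>.and (self_mem_nhdsWithin (a := (0:ℝ)) (s := {0}ᶜ))).exists
  obtain ⟨A₃, hA₃, hdisj₃⟩ := hcen (F.comp φ) δ hδ0 hzero
  have hsep : ∀ {s t : Set ℝ} (f : ℝ → ℝ), (∀ x ∈ s, ∀ y ∈ t, f x ≠ f y) → Disjoint s t :=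
    fun f hf => Set.disjoint_left.2 fun x hx hy => hf x hx x hy rfl
  have hold : ∀ i j, i ≠ j → ∀ x y, x ^ 2 - c ∈ (A i).region → y ^ 2 - c ∈ (A j).region →
      x ^ 2 - c ≠ y ^ 2 - c := fun i j hij x y hx hy he =>
    Set.disjoint_left.1 (hdisj hij) hx (he ▸ hy)
  have h12 : ∀ i j, Disjoint (A₁ i).region (A₂ j).region := fun i j =>
    Set.disjoint_left.2 fun x hx hy => by linarith [(hA₁ i x hx).1, (hA₂ j x hy).1]
  have h13 : ∀ i j, Disjoint (A₁ i).region (A₃ j).region := fun i j =>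
    Set.disjoint_left.2 fun x hx hy => by
      linarith [(hA₁ i x hx).1, (abs_lt.1 (hA₃ j x hy)).2]
  have h23 : ∀ i j, Disjoint (A₂ i).region (A₃ j).region := fun i j =>
    Set.disjoint_left.2 fun x hx hy => by
      linarith [(hA₂ i x hx).1, (abs_lt.1 (hA₃ j x hy)).1]
  refine ⟨G.comp φ, F.comp φ + C δ * P, ?_, ?_, ⟨ι ⊕ ι ⊕ Fin n, inferInstance,
    Sum.elim (fun i => { A₁ i with sign := hδ₁ i })
      (Sum.elim (fun i => { A₂ i with sign := hδ₂ i }) A₃), ?_, ?_⟩, fun htop => ⟨?_, ?_⟩⟩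
  · rw [natDegree_comp, hdφ, mul_comm]
  · refine (natDegree_add_le _ _).trans (max_le_max ?_ ((natDegree_C_mul_le _ _).trans hP))
    rw [natDegree_comp, hdφ, mul_comm]
  · simp only [Fintype.card_sum, Fintype.card_fin, hcard]; ring
  · rintro (i | i | i) (j | j | j) hij
    · exact hsep (fun x => x ^ 2 - c) fun x hx y hy =>
        hold i j (fun h => hij (h ▸ rfl)) x y (hA₁ i x hx).2 (hA₁ j y hy).2
    · exact h12 i j
    · exact h13 i j
    · exact (h12 j i).symm
    · exact hsep (fun x => x ^ 2 - c) fun x hx y hy =>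
        hold i j (fun h => hij (h ▸ rfl)) x y (hA₂ i x hx).2 (hA₂ j y hy).2
    · exact h23 i j
    · exact (h13 j i).symm
    · exact (h23 j i).symm
    · exact hdisj₃ fun h => hij (h ▸ rfl)
  · have hsq : Tendsto (fun x : ℝ => x ^ 2 - c) atBot atTop :=
      tendsto_atTop_add_const_right _ _
      (((tendsto_pow_atTop two_ne_zero).comp tendsto_abs_atBot_atTop).congr fun x => sq_abs x)
    filter_upwards [hsq.eventually htop, eventually_lt_atBot 0] with x hx h0
    rw [derivative_comp_sq_sub]
    exact mul_pos_of_neg_of_neg (by linarith) hx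
  · have hsq : Tendsto (fun x : ℝ => x ^ 2 - c) atTop atTop :=
      tendsto_atTop_add_const_right _ _ (tendsto_pow_atTop two_ne_zero)
    filter_upwards [hsq.eventually htop, eventually_gt_atTop 0] with x hx h0
    rw [derivative_comp_sq_sub]
    exact mul_neg_of_pos_of_neg (by linarith) hx

lemma HasAnnuli.hGe {G F : ℝ[X]} {h n m : ℕ} (hA : HasAnnuli G F h) (hG : G.natDegree ≤ m + 1)
    (hF : F.natDegree ≤ n + 1) : HGe n m h := by
  obtain ⟨ι, _, A, rfl, hdisj⟩ := hA
  obtain ⟨c, ε₀, hε₀, H⟩ := exists_limitCycles_of_annuli A hdisj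
  refine ⟨(F + C c * X).derivative, G.derivative, ?_,
    (natDegree_derivative_le G).trans (by omega), ε₀, hε₀, fun ε h0 hε => ?_⟩
  · refine (natDegree_derivative_le _).trans ?_
    have : (F + C c * X).natDegree ≤ n + 1 :=
      natDegree_add_le_of_degree_le hF 
        ((natDegree_C_mul_le _ _).trans (natDegree_X_le.trans (by omega)))
    omega
  · obtain ⟨S, hS, hcard⟩ := H ε h0 hε
    exact ⟨S, hS, by rw [hcard]⟩

end Doubling

section Counting
open Set Topology

/-- The lower bound for the number of limit cycles, as a function of `m + 2`. -/
noncomputable def cycleBound (M : ℝ) : ℝ := M / 3 * Real.logb 2 (M / 6) + 1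

lemma cycleBound_eq {M : ℝ} (hM : 0 < M) :
    M * Real.log M / (3 * Real.log 2) - M / 3 * (1 + Real.log 3 / Real.log 2) + 1 =
      cycleBound M := by
  have h2 : Real.log 2 ≠ 0 := (Real.log_pos one_lt_two).ne'
  have h6 : Real.log 6 = Real.log 2 + Real.log 3 := by
    rw [← Real.log_mul (by norm_num) (by norm_num)]; norm_num
  rw [cycleBound, Real.logb, Real.log_div hM.ne' (by norm_num), h6]
  field_simp

lemma cycleBound_mono {M N : ℝ} (hM : 6 ≤ M) (hMN : M ≤ N) : cycleBound M ≤ cycleBound N := by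
  have h1 : Real.logb 2 (M / 6) ≤ Real.logb 2 (N / 6) :=
    Real.logb_le_logb_of_le one_lt_two (by linarith) (by linarith)
  have h2 : 0 ≤ Real.logb 2 (M / 6) := Real.logb_nonneg one_lt_two (by linarith)
  rw [cycleBound, cycleBound]
  have := mul_le_mul (by linarith : M / 3 ≤ N / 3) h1 h2 (by linarith)
  linarith

lemma cycleBound_two_mul {M : ℝ} (hM : 0 < M) :
    cycleBound (2 * M) = 2 * cycleBound M + 2 * M / 3 - 1 := by
  rw [cycleBound, cycleBound, mul_div_assoc 2 M 6, Real.logb_mul two_ne_zero (by positivity),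
    Real.logb_self_eq_one one_lt_two]
  ring

lemma cycleBound_le {M a : ℝ} (hM : 0 < M) (ha : M / 6 ≤ 2 ^ a) :
    cycleBound M ≤ M / 3 * a + 1 := by
  have := (Real.logb_le_iff_le_rpow one_lt_two (by linarith)).2 ha
  rw [cycleBound]
  gcongr

lemma cycleBound_five_le : cycleBound 5 ≤ 1 := by
  simpa using cycleBound_le (M := 5) (a := 0) (by norm_num) (by norm_num)

lemma cycleBound_six_le : cycleBound 6 ≤ 1 := by
  simpa using cycleBound_le (M := 6) (a := 0) (by norm_num) (by norm_num)

lemma cycleBound_eight_le : cycleBound 8 ≤ 4 :=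
  (cycleBound_le (M := 8) (a := 1) (by norm_num) (by norm_num)).trans (by norm_num)

lemma cycleBound_seven_le : cycleBound 7 ≤ 2 := by
  refine (cycleBound_le (M := 7) (a := 3 / 7) (by norm_num) ?_).trans (by norm_num)
  refine le_of_pow_le_pow_left₀ (n := 7) (by norm_num) (by positivity) ?_
  rw [← Real.rpow_mul_natCast (by norm_num)]
  norm_num

lemma cycleBound_sixteen_le : cycleBound 16 ≤ 10 :=
  (cycleBound_le (M := 16) (a := 3 / 2) (by norm_num) (by
    refine le_of_pow_le_pow_left₀ (n := 2) (by norm_num) (by positivity) ?_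
    rw [← Real.rpow_mul_natCast (by norm_num)]
    norm_num)).trans (by norm_num)

lemma hasAnnuli_zero (G F : ℝ[X]) : HasAnnuli G F 0 :=
  ⟨Empty, inferInstance, Empty.elim, rfl, fun i => i.elim⟩

lemma exists_hasAnnuli (q : ℕ) (hq : 2 ≤ q) :
    ∃ (G F : ℝ[X]) (h : ℕ), G.natDegree ≤ q ∧ F.natDegree ≤ q - 1 ∧ HasAnnuli G F h ∧
      (∀ᶠ x in atBot, 0 < G.derivative.eval x) ∧ (∀ᶠ x in atTop, G.derivative.eval x < 0) ∧
      (4 ≤ q → q ≠ 7 → cycleBound (q + 1) ≤ h) ∧ (q = 7 → 2 ≤ h) := by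
  induction q using Nat.strong_induction_on with
  | _ q ih =>
    rcases lt_or_ge q 4 with h4 | h4
    · refine ⟨-X ^ 2, 0, 0, by simpa using hq, by simp, hasAnnuli_zero _ _, ?_, ?_, by omega,
        by omega⟩
      · filter_upwards [eventually_lt_atBot 0] with x hx
        have : 2 * x < 0 := by linarith
        simpa [← one_add_one_eq_two] using this
      · filter_upwards [eventually_gt_atTop 0] with x hx
        have : 0 < 2 * x := by linarith
        simpa [← one_add_one_eq_two] using this
    set p := q / 2 with hp
    obtain ⟨G, F, h, hG, hF, hA, hbot, htop, hB, h7⟩ := ih p (by omega) (by omega)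
    obtain ⟨G', F', hG', hF', hA', himp⟩ := hA.double hbot (p - 1)
    refine ⟨G', F', _, hG'.trans (by omega), hF'.trans (max_le (by omega) (by omega)), hA',
      (himp htop).1, (himp htop).2, fun _ hq7 => ?_, fun _ => by omega⟩
    have hcases : q = 4 ∨ q = 5 ∨ q = 6 ∨ q = 14 ∨ q = 15 ∨ (8 ≤ q ∧ 4 ≤ p ∧ p ≠ 7) := by omega
    have hsmall : ∀ (M : ℝ) (k : ℕ), cycleBound M ≤ k → (q : ℝ) + 1 = M →
        k ≤ 2 * h + (p - 1) → cycleBound (q + 1) ≤ (2 * h + (p - 1) : ℕ) :=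
      fun M k hk hM hle => hM ▸ hk.trans (Nat.cast_le.2 hle)
    rcases hcases with hq | hq | hq | hq | hq | ⟨h8, hp4, hp7⟩
    · exact hsmall 5 1 (by simpa using cycleBound_five_le) (by rw [hq]; norm_num) (by omega)
    · exact hsmall 6 1 (by simpa using cycleBound_six_le) (by rw [hq]; norm_num) (by omega)
    · exact hsmall 7 2 (by simpa using cycleBound_seven_le) (by rw [hq]; norm_num) (by omega)
    · exact hsmall 15 10 ((cycleBound_mono (by norm_num) (by norm_num)).trans
        cycleBound_sixteen_le) (by rw [hq]; norm_num) (by omega)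
    · exact hsmall 16 10 (by simpa using cycleBound_sixteen_le) (by rw [hq]; norm_num) (by omega)
    · have h1 := hB hp4 hp7
      have h2 : cycleBound (q + 1) ≤ cycleBound (2 * (p + 1)) := by
        refine cycleBound_mono ?_ ?_
        · have : (8:ℝ) ≤ q := by exact_mod_cast h8
          linarith
        · have : q + 1 ≤ 2 * (p + 1) := by omega
          exact_mod_cast this
      have hp4' : (4:ℝ) ≤ p := by exact_mod_cast hp4
      rw [cycleBound_two_mul (by positivity)] at h2
      push_cast [Nat.cast_sub (by omega : 1 ≤ p)]
      linarith

lemma exists_hasAnnuli_seven :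
    ∃ G F : ℝ[X], G.natDegree ≤ 6 ∧ F.natDegree ≤ 6 ∧ HasAnnuli G F 4 := by
  set G : ℝ[X] := C (1 / 2) * X ^ 2 + C (1 / 3) * X ^ 3 with hG
  have hGB : ∀ x, G.eval x = (C (1 / 2) + C (1 / 3) * X : ℝ[X]).eval x * x ^ 2 + 0 := fun x => by
    simp [hG]; ring
  obtain ⟨ξ, dξ, ρ, hch, h0, hone, -⟩ := exists_chart hGB (by simp)
  obtain ⟨P, hP, hex⟩ := hch.exists_annuli h0 hone 1
  obtain ⟨A, -, hdisj⟩ := hex 0 1 one_ne_zero fun r _ _ => by simp [melnikov]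
  have hA : HasAnnuli G (0 + C 1 * P) 1 := ⟨Fin 1, inferInstance, A, rfl, hdisj⟩
  have hbot : ∀ᶠ x in atBot, 0 < G.derivative.eval x := by
    filter_upwards [eventually_lt_atBot (-1)] with x hx
    have : G.derivative.eval x = x * (x + 1) := by simp [hG]; ring
    rw [this]
    exact mul_pos_of_neg_of_neg (by linarith) (by linarith)
  have hdG : G.natDegree ≤ 3 := natDegree_add_le_of_degree_le
    ((natDegree_C_mul_X_pow_le _ _).trans (by norm_num)) (natDegree_C_mul_X_pow_le _ _)
  obtain ⟨G', F', hG', hF', hA', -⟩ := hA.double hbot 2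
  refine ⟨G', F', hG'.trans (by omega), hF'.trans (max_le ?_ (by norm_num)), hA'⟩
  simp only [map_one, one_mul, zero_add]
  omega

lemma HGe.mono {n m : ℕ} {c d : ℝ} (h : HGe n m c) (hd : d ≤ c) : HGe n m d := by
  obtain ⟨f, g, hf, hg, ε₀, hε₀, H⟩ := h
  refine ⟨f, g, hf, hg, ε₀, hε₀, fun ε h0 hε => ?_⟩
  obtain ⟨S, hS, hc⟩ := H ε h0 hε
  exact ⟨S, hS, hd.trans hc⟩

end Counting

theorem stmt16 (m : ℕ) (hm : 3 ≤ m) :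
    HGe (m - 1) m (((m : ℝ) + 2) * Real.log ((m : ℝ) + 2) / (3 * Real.log 2)
      - ((m : ℝ) + 2) / 3 * (1 + Real.log 3 / Real.log 2) + 1) := by
  rw [cycleBound_eq (by positivity)]
  rcases eq_or_ne m 6 with rfl | h6
  · obtain ⟨G, F, hG, hF, hA⟩ := exists_hasAnnuli_seven
    refine (hA.hGe (hG.trans (by norm_num)) (hF.trans (by norm_num))).mono ?_
    have := cycleBound_eight_le
    norm_num at *
    linarith
  · obtain ⟨G, F, h, hG, hF, hA, -, -, hB, -⟩ := exists_hasAnnuli (m + 1) (by omega)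
    refine (hA.hGe hG (hF.trans (by omega))).mono ?_
    have := hB (by omega) (by omega)
    push_cast at this
    rwa [add_assoc, one_add_one_eq_two] at this
end

section
/- Let l ≥ 1 be an integer and let G₁ be a real polynomial of degree 2l with positive leading coefficient G₀. For all sufficiently large h > 0 the equation G₁(x) = h has a smallest real root a(h) and a largest real root b(h), with G₁(x) < h for all x in the open interval (a(h), b(h)); for such h and each integer j ≥ 0 define I_j(h) = −2·∫_{a(h)}^{b(h)} x^{2j+1}·G₁'(x)/√(2(h − G₁(x))) dx (a convergent improper integral). Then for each integer j ≥ 0 there exists a constant α_j > 0 such that lim_{h→∞} I_j(h)/h^{(2j+l+1)/(2l)} = −α_j; equivalently, I_j(h) = −α_j·h^{(2j+l+1)/(2l)}·(1 + o(1)) as h → ∞. -/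
open Filter Polynomial

/-- The derivative of a polynomial of degree at least two with positive leading coefficient is
eventually positive. -/
theorem Polynomial.eventually_derivative_eval_pos {P : ℝ[X]} (hdeg : 2 ≤ P.natDegree)
    (hlead : 0 < P.leadingCoeff) : ∀ᶠ x in atTop, 0 < P.derivative.eval x := by
  have hnat : P.derivative.natDegree = P.natDegree - 1 := natDegree_derivative P
  refine (tendsto_atTop_of_leadingCoeff_nonneg P.derivative ?_ ?_).eventually_gt_atTop 0
  · rw [← natDegree_pos_iff_degree_pos]; omega
  · rw [leadingCoeff, hnat, coeff_derivative, Nat.sub_add_cancel (by omega)]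
    exact mul_nonneg hlead.le (by positivity)

theorem Polynomial.leadingCoeff_comp_neg_X_of_even {P : ℝ[X]} (h : Even P.natDegree) :
    (P.comp (-X)).leadingCoeff = P.leadingCoeff := by
  rw [leadingCoeff_comp (by simp)]
  simp [h.neg_one_pow]

theorem Polynomial.tendsto_eval_atTop_atTop {P : ℝ[X]} (hdeg : 0 < P.natDegree)
    (hlead : 0 < P.leadingCoeff) : Tendsto (fun x => P.eval x) atTop atTop :=
  tendsto_atTop_of_leadingCoeff_nonneg P (natDegree_pos_iff_degree_pos.1 hdeg) hlead.le

theorem Polynomial.tendsto_eval_atBot_atTop {P : ℝ[X]} (hdeg : 0 < P.natDegree)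
    (heven : Even P.natDegree) (hlead : 0 < P.leadingCoeff) :
    Tendsto (fun x => P.eval x) atBot atTop := by
  have h := Polynomial.tendsto_eval_atTop_atTop (P := P.comp (-X))
    (by simpa [natDegree_comp] using hdeg)
    (by rwa [leadingCoeff_comp_neg_X_of_even heven])
  simpa [Function.comp_def] using h.comp tendsto_neg_atBot_atTop

theorem Polynomial.eventually_derivative_eval_neg {P : ℝ[X]} (hdeg : 2 ≤ P.natDegree)
    (heven : Even P.natDegree) (hlead : 0 < P.leadingCoeff) :
    ∀ᶠ x in atBot, P.derivative.eval x < 0 := by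
  have h := Polynomial.eventually_derivative_eval_pos (P := P.comp (-X))
    (by simpa [natDegree_comp] using hdeg)
    (by rwa [leadingCoeff_comp_neg_X_of_even heven])
  simpa [derivative_comp] using tendsto_neg_atBot_atTop.eventually h

/-- A polynomial of even degree `n` with positive leading coefficient `c` dominates
`c / 2 * x ^ n` up to a constant. -/
theorem Polynomial.exists_half_leadingCoeff_mul_pow_sub_le {P : ℝ[X]} (hdeg : 0 < P.natDegree)
    (heven : Even P.natDegree) (hlead : 0 < P.leadingCoeff) :
    ∃ C : ℝ, ∀ x, P.leadingCoeff / 2 * x ^ P.natDegree - C ≤ P.eval x := by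
  set n := P.natDegree with hn
  set c := P.leadingCoeff with hc
  set Q : ℝ[X] := P - Polynomial.C (c / 2) * X ^ n with hQ
  have hcoeff : Q.coeff n = c / 2 := by
    have : P.coeff n = c := rfl
    simp [hQ, this]; ring
  have hQn : Q.natDegree = n := by
    refine natDegree_eq_of_le_of_coeff_ne_zero ?_ (by rw [hcoeff]; positivity)
    simpa only [max_self] using natDegree_sub_le_of_le hn.ge (natDegree_C_mul_X_pow_le (c / 2) n)
  have hQl : 0 < Q.leadingCoeff := by rw [leadingCoeff, hQn, hcoeff]; positivity
  obtain ⟨y, hy⟩ := Q.continuous.exists_forall_le (by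
    rw [cocompact_eq_atBot_atTop]
    exact (Q.tendsto_eval_atBot_atTop (by rwa [hQn]) (by rwa [hQn]) hQl).sup
      (Q.tendsto_eval_atTop_atTop (by rwa [hQn]) hQl))
  refine ⟨-Q.eval y, fun x => ?_⟩
  have := hy x
  simp only [hQ, eval_sub, eval_mul, eval_C, eval_pow, eval_X] at this ⊢
  linarith

theorem Polynomial.tendsto_eval_mul_div_pow (P : ℝ[X]) (u : ℝ) :
    Tendsto (fun s : ℝ => P.eval (s * u) / s ^ P.natDegree) atTop
      (nhds (P.leadingCoeff * u ^ P.natDegree)) := by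
  simp only [eval_eq_sum_range, Finset.sum_range_succ, add_div, Finset.sum_div]
  rw [← zero_add (P.leadingCoeff * u ^ P.natDegree)]
  refine Filter.Tendsto.add ?_ ?_
  · rw [← Finset.sum_const_zero (s := Finset.range P.natDegree)]
    refine tendsto_finsetSum _ fun i hi => ?_
    have h := (tendsto_pow_div_pow_atTop_zero (𝕜 := ℝ)
      (Finset.mem_range.1 hi)).const_mul (P.coeff i * u ^ i)
    rw [mul_zero] at h
    exact h.congr fun s => by rw [mul_pow]; ring
  · refine tendsto_const_nhds.congr' ?_
    filter_upwards [eventually_gt_atTop 0] with s hs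
    rw [mul_pow, leadingCoeff]
    field_simp

/-- Outside a compact interval, a polynomial of even degree with positive leading coefficient is
strictly monotone, and its large level sets have a least and a greatest element. -/
theorem Polynomial.exists_level_endpoints {P : ℝ[X]} (hdeg : 2 ≤ P.natDegree)
    (heven : Even P.natDegree) (hlead : 0 < P.leadingCoeff) :
    ∃ R h₀ : ℝ, 0 < R ∧ 0 < h₀ ∧ (∀ x, R ≤ x → 0 < P.derivative.eval x) ∧
      (∀ x, x ≤ -R → P.derivative.eval x < 0) ∧
      ∃ a b : ℝ → ℝ, ∀ h, h₀ < h → a h < -R ∧ R < b h ∧ P.eval (a h) = h ∧ P.eval (b h) = h ∧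
        (∀ x ∈ Set.Ioo (a h) (b h), P.eval x < h) ∧ (∀ x < a h, h < P.eval x) ∧
        ∀ x, b h < x → h < P.eval x := by
  obtain ⟨R₁, hR₁⟩ := eventually_atTop.1 (P.eventually_derivative_eval_pos hdeg hlead)
  obtain ⟨R₂, hR₂⟩ := eventually_atBot.1 (P.eventually_derivative_eval_neg hdeg heven hlead)
  obtain ⟨R, hR0, hRR₁, hRR₂⟩ : ∃ R : ℝ, 0 < R ∧ R₁ ≤ R ∧ -R₂ ≤ R :=
    ⟨max 1 (max R₁ (-R₂)), by positivity, by simp, by simp⟩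
  have hpos : ∀ x, R ≤ x → 0 < P.derivative.eval x := fun x hx => hR₁ x (hRR₁.trans hx)
  have hneg : ∀ x, x ≤ -R → P.derivative.eval x < 0 := fun x hx => hR₂ x (by linarith)
  obtain ⟨M, hM⟩ := (isCompact_Icc (a := -R) (b := R)).bddAbove_image P.continuous.continuousOn
  have hM' : ∀ x, -R ≤ x → x ≤ R → P.eval x ≤ M := fun x h₁ h₂ =>
    hM (Set.mem_image_of_mem _ ⟨h₁, h₂⟩)
  have hmono : StrictMonoOn (fun x => P.eval x) (Set.Ici R) :=
    strictMonoOn_of_deriv_pos (convex_Ici R) P.continuous.continuousOn fun x hx => by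
      rw [interior_Ici] at hx
      simpa using hpos x hx.le
  have hanti : StrictAntiOn (fun x => P.eval x) (Set.Iic (-R)) :=
    strictAntiOn_of_deriv_neg (convex_Iic (-R)) P.continuous.continuousOn fun x hx => by
      rw [interior_Iic] at hx
      simpa using hneg x hx.le
  have key : ∀ h, max 1 M < h → ∃ p : ℝ × ℝ, p.1 < -R ∧ R < p.2 ∧ P.eval p.1 = h ∧
      P.eval p.2 = h ∧ (∀ x ∈ Set.Ioo p.1 p.2, P.eval x < h) ∧ (∀ x < p.1, h < P.eval x) ∧
        ∀ x, p.2 < x → h < P.eval x := by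
    intro h hh
    have hMh : M < h := (le_max_right _ _).trans_lt hh
    obtain ⟨y, hy⟩ := ((P.tendsto_eval_atTop_atTop (by omega) hlead).eventually_ge_atTop h
      |>.and (eventually_ge_atTop R)).exists
    obtain ⟨z, hz⟩ := ((P.tendsto_eval_atBot_atTop (by omega) heven hlead).eventually_ge_atTop h
      |>.and (eventually_le_atBot (-R))).exists
    obtain ⟨b, hb, hbh⟩ := intermediate_value_Icc hy.2 P.continuous.continuousOn
      ⟨(hM' R (by linarith) le_rfl).trans hMh.le, hy.1⟩
    obtain ⟨a, ha, hah⟩ := intermediate_value_Icc' hz.2 P.continuous.continuousOn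
      ⟨(hM' (-R) le_rfl (by linarith)).trans hMh.le, hz.1⟩
    simp only at hbh hah
    have hRb : R < b := hb.1.lt_of_ne fun e => by
      have := hM' R (by linarith) le_rfl
      rw [e, hbh] at this; linarith
    have haR : a < -R := ha.2.lt_of_ne fun e => by
      have := hM' (-R) le_rfl (by linarith)
      rw [← e, hah] at this; linarith
    refine ⟨(a, b), haR, hRb, hah, hbh, fun x hx => ?_, fun x hx => ?_, fun x hx => ?_⟩
    · rcases le_total x (-R) with h₁ | h₁
      · exact (hanti (Set.mem_Iic.2 haR.le) h₁ hx.1).trans_eq hah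
      · rcases le_total x R with h₂ | h₂
        · exact (hM' x h₁ h₂).trans_lt hMh
        · exact (hmono h₂ hRb.le hx.2).trans_eq hbh
    · simpa only [hah] using hanti (Set.mem_Iic.2 (hx.le.trans haR.le)) (Set.mem_Iic.2 haR.le) hx
    · simpa only [hbh] using hmono (Set.mem_Ici.2 hRb.le) (Set.mem_Ici.2 (hRb.le.trans hx.le)) hx
  choose! p hp using key
  exact ⟨R, max 1 M, hR0, by positivity, hpos, hneg, fun h => (p h).1, fun h => (p h).2, hp⟩

theorem Polynomial.hasDerivAt_sqrt_level (P : ℝ[X]) {h x : ℝ} (hx : P.eval x < h) :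
    HasDerivAt (fun x => √(2 * (h - P.eval x)))
      (-(P.derivative.eval x / √(2 * (h - P.eval x)))) x := by
  have hpos : 0 < 2 * (h - P.eval x) := by linarith
  convert (((P.hasDerivAt x).const_sub h).const_mul 2).sqrt hpos.ne' using 1
  ring

theorem Polynomial.continuous_sqrt_level (P : ℝ[X]) (h : ℝ) :
    Continuous fun x => √(2 * (h - P.eval x)) := by
  fun_prop

/-- The singularities of `P.derivative / √(2 * (h - P))` at the ends of a level interval are integrable
as soon as the derivative has a constant sign near each endpoint. -/
theorem Polynomial.intervalIntegrable_derivative_div_sqrt (P : ℝ[X]) {a b R h : ℝ}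
    (hR : 0 < R) (ha : a < -R) (hb : R < b) (hlt : ∀ x ∈ Set.Ioo a b, P.eval x < h)
    (hpos : ∀ x, R ≤ x → 0 < P.derivative.eval x)
    (hneg : ∀ x, x ≤ -R → P.derivative.eval x < 0) :
    IntervalIntegrable (fun x => P.derivative.eval x / √(2 * (h - P.eval x)))
      MeasureTheory.volume a b := by
  have hleft : IntervalIntegrable (fun x => P.derivative.eval x / √(2 * (h - P.eval x)))
      MeasureTheory.volume a (-R) := by
    have := intervalIntegral.intervalIntegrable_deriv_of_nonneg (a := a) (b := -R)
      (g := fun x => √(2 * (h - P.eval x)))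
      (g' := fun x => -(P.derivative.eval x / √(2 * (h - P.eval x))))
      (P.continuous_sqrt_level h).continuousOn
      (fun x hx => by
        rw [min_eq_left ha.le, max_eq_right ha.le] at hx
        exact P.hasDerivAt_sqrt_level (hlt x ⟨hx.1, by linarith [hx.2]⟩))
      (fun x hx => by
        rw [min_eq_left ha.le, max_eq_right ha.le] at hx
        rw [← neg_div]
        exact div_nonneg (by linarith [hneg x hx.2.le]) (Real.sqrt_nonneg _))
    simpa only [Pi.neg_def, neg_neg] using this.neg
  have hright : IntervalIntegrable (fun x => P.derivative.eval x / √(2 * (h - P.eval x)))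
      MeasureTheory.volume R b := by
    refine intervalIntegral.intervalIntegrable_deriv_of_nonneg
      (g := fun x => -√(2 * (h - P.eval x))) (P.continuous_sqrt_level h).neg.continuousOn
      (fun x hx => ?_) (fun x hx => ?_)
    · rw [min_eq_left hb.le, max_eq_right hb.le] at hx
      simpa only [neg_neg] using
        (P.hasDerivAt_sqrt_level (hlt x ⟨by linarith [hx.1], hx.2⟩)).fun_neg
    · rw [min_eq_left hb.le, max_eq_right hb.le] at hx
      exact div_nonneg (hpos x hx.1.le).le (Real.sqrt_nonneg _)
  have hmid : IntervalIntegrable (fun x => P.derivative.eval x / √(2 * (h - P.eval x)))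
      MeasureTheory.volume (-R) R := by
    refine (P.derivative.continuous.continuousOn.div
      (P.continuous_sqrt_level h).continuousOn fun x hx => ?_).intervalIntegrable
    rw [Set.uIcc_of_le (by linarith)] at hx
    have := hlt x ⟨by linarith [hx.1], by linarith [hx.2]⟩
    exact (Real.sqrt_pos.2 (by linarith)).ne'
  exact (hleft.trans hmid).trans hright

/-- Integration by parts, the boundary terms vanishing because `P = h` at both endpoints. -/
theorem Polynomial.integral_pow_mul_derivative_div_sqrt (P : ℝ[X]) {a b h : ℝ} (hab : a ≤ b)
    (ha : P.eval a = h) (hb : P.eval b = h) (hlt : ∀ x ∈ Set.Ioo a b, P.eval x < h)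
    (hint : IntervalIntegrable (fun x => P.derivative.eval x / √(2 * (h - P.eval x)))
      MeasureTheory.volume a b) (j : ℕ) :
    ∫ x in a..b, x ^ (2 * j + 1) * P.derivative.eval x / √(2 * (h - P.eval x)) =
      (2 * j + 1) * ∫ x in a..b, x ^ (2 * j) * √(2 * (h - P.eval x)) := by
  have := intervalIntegral.integral_mul_deriv_eq_deriv_mul_of_hasDeriv_right (a := a) (b := b)
    (u := fun x => x ^ (2 * j + 1)) (u' := fun x => (2 * j + 1) * x ^ (2 * j))
    (v := fun x => √(2 * (h - P.eval x)))
    (v' := fun x => -(P.derivative.eval x / √(2 * (h - P.eval x))))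
    (by fun_prop) (P.continuous_sqrt_level h).continuousOn
    (fun x _ => by simpa using (hasDerivAt_pow (2 * j + 1) x).hasDerivWithinAt)
    (fun x hx => by
      rw [min_eq_left hab, max_eq_right hab] at hx
      exact (P.hasDerivAt_sqrt_level (hlt x hx)).hasDerivWithinAt)
    (Continuous.intervalIntegrable (by fun_prop) _ _) hint.neg
  simp only [ha, hb, sub_self, mul_zero, Real.sqrt_zero, zero_sub, mul_neg,
    intervalIntegral.integral_neg, neg_inj, mul_assoc, intervalIntegral.integral_const_mul] at this
  simpa only [mul_div_assoc] using this

/-- Rescaling `x = s u`. Note that the integrand vanishes where `P > s ^ n`. -/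
theorem Polynomial.integral_pow_mul_sqrt_level_scale (P : ℝ[X]) (l j : ℕ) {s : ℝ} (hs : 0 < s) :
    ∫ x : ℝ, x ^ (2 * j) * √(2 * (s ^ (2 * l) - P.eval x)) =
      s ^ (2 * j + l + 1) *
        ∫ u : ℝ, u ^ (2 * j) * √(2 * (1 - P.eval (s * u) / s ^ (2 * l))) := by
  have hscale := MeasureTheory.Measure.integral_comp_mul_left
    (fun x : ℝ => x ^ (2 * j) * √(2 * (s ^ (2 * l) - P.eval x))) s
  have hpt : ∀ u : ℝ, (s * u) ^ (2 * j) * √(2 * (s ^ (2 * l) - P.eval (s * u))) =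
      s ^ (2 * j + l) * (u ^ (2 * j) * √(2 * (1 - P.eval (s * u) / s ^ (2 * l)))) := by
    intro u
    have : 2 * (s ^ (2 * l) - P.eval (s * u)) =
        (s ^ l) ^ 2 * (2 * (1 - P.eval (s * u) / s ^ (2 * l))) := by
      field_simp
      ring
    rw [this, Real.sqrt_mul (by positivity), Real.sqrt_sq (by positivity)]
    ring
  simp only [hpt, MeasureTheory.integral_const_mul, smul_eq_mul,
    abs_of_pos (inv_pos.2 hs)] at hscale
  rw [pow_succ, mul_right_comm, hscale]
  field_simp

theorem integrable_pow_mul_sqrt {c K : ℝ} (hc : 0 < c) {l : ℕ} (hl : 1 ≤ l) (j : ℕ) :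
    MeasureTheory.Integrable fun u : ℝ => u ^ (2 * j) * √(2 * (K - c * u ^ (2 * l))) := by
  have hcont : Continuous fun u : ℝ => u ^ (2 * j) * √(2 * (K - c * u ^ (2 * l))) := by fun_prop
  refine hcont.integrable_of_hasCompactSupport
    (HasCompactSupport.intro (isCompact_Icc (a := -(1 + |K| / c)) (b := 1 + |K| / c))
      fun u hu => ?_)
  have habs : 1 + |K| / c < |u| := by
    by_contra! hle
    exact hu (abs_le.1 hle)
  have h1 : |u| ≤ u ^ (2 * l) := by
    rw [← (even_two_mul l).pow_abs]
    exact le_self_pow₀ (by linarith [div_nonneg (abs_nonneg K) hc.le]) (by omega)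
  have h2 : |K| / c < u ^ (2 * l) := by linarith
  rw [div_lt_iff₀ hc] at h2
  rw [Real.sqrt_eq_zero_of_nonpos (by linarith [le_abs_self K]), mul_zero]

theorem integral_pow_mul_sqrt_pos {c : ℝ} (hc : 0 < c) {l : ℕ} (hl : 1 ≤ l) (j : ℕ) :
    0 < ∫ u : ℝ, u ^ (2 * j) * √(2 * (1 - c * u ^ (2 * l))) := by
  have hcont : Continuous fun u : ℝ => u ^ (2 * j) * √(2 * (1 - c * u ^ (2 * l))) := by fun_prop
  have hev : ∀ᶠ u : ℝ in nhds 0, c * u ^ (2 * l) < 1 := by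
    have : ContinuousAt (fun u : ℝ => c * u ^ (2 * l)) 0 := by fun_prop
    refine this.eventually_lt_const ?_
    simp [show l ≠ 0 by omega]
  obtain ⟨u, hu, hu0⟩ := ((hev.filter_mono nhdsWithin_le_nhds).and
    (self_mem_nhdsWithin : Set.Ioi (0 : ℝ) ∈ nhdsWithin 0 (Set.Ioi 0))).exists
  refine MeasureTheory.integral_pos_of_integrable_nonneg_nonzero (x := u) hcont
    (integrable_pow_mul_sqrt hc hl j)
    (fun v => mul_nonneg ((even_two_mul j).pow_nonneg v) (Real.sqrt_nonneg _))
    (mul_ne_zero (pow_ne_zero _ (ne_of_gt hu0)) (Real.sqrt_pos.2 (by linarith)).ne')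

theorem Polynomial.tendsto_integral_pow_mul_sqrt_scaled {P : ℝ[X]} {l : ℕ} (hl : 1 ≤ l)
    (hdeg : P.natDegree = 2 * l) (hlead : 0 < P.leadingCoeff) (j : ℕ) :
    Tendsto (fun s : ℝ => ∫ u : ℝ, u ^ (2 * j) * √(2 * (1 - P.eval (s * u) / s ^ (2 * l)))) atTop
      (nhds (∫ u : ℝ, u ^ (2 * j) * √(2 * (1 - P.leadingCoeff * u ^ (2 * l))))) := by
  obtain ⟨C, hC⟩ := P.exists_half_leadingCoeff_mul_pow_sub_le (by omega)
    (hdeg ▸ even_two_mul l) hlead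
  rw [hdeg] at hC
  refine MeasureTheory.tendsto_integral_filter_of_dominated_convergence
    (fun u => u ^ (2 * j) * √(2 * (2 - P.leadingCoeff / 2 * u ^ (2 * l))))
    (Eventually.of_forall fun s => Continuous.aestronglyMeasurable (by fun_prop)) ?_
    (integrable_pow_mul_sqrt (half_pos hlead) hl j)
    (Eventually.of_forall fun u => ?_)
  · have hlim : Tendsto (fun s : ℝ => s ^ (2 * l)) atTop atTop := tendsto_pow_atTop (by omega)
    filter_upwards [eventually_gt_atTop 0, hlim.eventually_ge_atTop C] with s hs hsC
    refine Eventually.of_forall fun u => ?_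
    have heven : 0 ≤ u ^ (2 * j) := (even_two_mul j).pow_nonneg u
    rw [Real.norm_of_nonneg (mul_nonneg heven (Real.sqrt_nonneg _))]
    have hsl : 0 < s ^ (2 * l) := by positivity
    have : P.leadingCoeff / 2 * u ^ (2 * l) - 1 ≤ P.eval (s * u) / s ^ (2 * l) := by
      rw [le_div_iff₀ hsl]
      have := hC (s * u)
      rw [mul_pow] at this
      linarith
    exact mul_le_mul_of_nonneg_left (Real.sqrt_le_sqrt (by linarith)) heven
  · have := P.tendsto_eval_mul_div_pow u
    rw [hdeg] at this
    exact (((this.const_sub 1).const_mul 2).sqrt).const_mul _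

theorem stmt18 (l : ℕ) (hl : 1 ≤ l) (G₁ : Polynomial ℝ)
    (hdeg : G₁.natDegree = 2 * l) (hlead : 0 < G₁.leadingCoeff) :
    ∃ h₀ : ℝ, 0 < h₀ ∧ ∃ a b : ℝ → ℝ,
      (∀ h : ℝ, h₀ < h →
        IsLeast {x : ℝ | G₁.eval x = h} (a h) ∧
        IsGreatest {x : ℝ | G₁.eval x = h} (b h) ∧
        (∀ x ∈ Set.Ioo (a h) (b h), G₁.eval x < h) ∧
        ∀ j : ℕ, IntervalIntegrable
          (fun x : ℝ => x ^ (2 * j + 1) * (G₁.derivative.eval x)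
            / Real.sqrt (2 * (h - G₁.eval x)))
          MeasureTheory.volume (a h) (b h)) ∧
      ∀ j : ℕ, ∃ α : ℝ, 0 < α ∧
        Tendsto (fun h : ℝ =>
            (-2 * ∫ x in (a h)..(b h),
              x ^ (2 * j + 1) * (G₁.derivative.eval x)
                / Real.sqrt (2 * (h - G₁.eval x)))
            / h ^ ((2 * (j : ℝ) + l + 1) / (2 * (l : ℝ))))
          atTop (nhds (-α)) := by
  have heven : Even G₁.natDegree := hdeg ▸ even_two_mul l
  obtain ⟨R, h₀, hR, hh₀, hpos, hneg, a, b, hab⟩ :=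
    G₁.exists_level_endpoints (by omega) heven hlead
  have hint : ∀ h, h₀ < h → IntervalIntegrable
      (fun x => G₁.derivative.eval x / √(2 * (h - G₁.eval x))) MeasureTheory.volume (a h) (b h) :=
    fun h hh => by
      obtain ⟨haR, hRb, -, -, hlt, -, -⟩ := hab h hh
      exact G₁.intervalIntegrable_derivative_div_sqrt hR haR hRb hlt hpos hneg
  refine ⟨h₀, hh₀, a, b, fun h hh => ?_, fun j => ?_⟩
  · obtain ⟨haR, hRb, hah, hbh, hlt, hla, hlb⟩ := hab h hh
    refine ⟨⟨hah, fun x hx => ?_⟩, ⟨hbh, fun x hx => ?_⟩, hlt, fun j => ?_⟩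
    · by_contra! hxa
      exact (hla x hxa).ne' hx
    · by_contra! hbx
      exact (hlb x hbx).ne' hx
    · simpa only [mul_div_assoc] using
        (hint h hh).continuousOn_mul (continuous_pow (2 * j + 1)).continuousOn
  · have hI := integral_pow_mul_sqrt_pos hlead hl j
    refine ⟨2 * (2 * j + 1) * ∫ u : ℝ, u ^ (2 * j) * √(2 * (1 - G₁.leadingCoeff * u ^ (2 * l))),
      by positivity, ?_⟩
    have hl0 : (0 : ℝ) < 2 * l := by positivity
    have hlim := ((G₁.tendsto_integral_pow_mul_sqrt_scaled hl hdeg hlead j).comp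
      (tendsto_rpow_atTop (one_div_pos.2 hl0))).const_mul (2 * (2 * (j : ℝ) + 1)) |>.neg
    refine hlim.congr' ?_
    filter_upwards [eventually_gt_atTop h₀] with h hh
    obtain ⟨haR, hRb, hah, hbh, hlt, hla, hlb⟩ := hab h hh
    have hh0 : 0 < h := hh₀.trans hh
    set s := h ^ (1 / (2 * (l : ℝ))) with hs_def
    have hs : 0 < s := Real.rpow_pos_of_pos hh0 _
    have hsh : s ^ (2 * l) = h := by
      rw [hs_def, ← Real.rpow_natCast, ← Real.rpow_mul hh0.le]
      push_cast
      rw [one_div_mul_cancel hl0.ne', Real.rpow_one]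
    have hsp : h ^ ((2 * (j : ℝ) + l + 1) / (2 * (l : ℝ))) = s ^ (2 * j + l + 1) := by
      rw [hs_def, ← Real.rpow_natCast, ← Real.rpow_mul hh0.le]
      push_cast
      congr 1
      ring
    have hle : a h ≤ b h := by linarith
    have hfull : ∫ x in (a h)..(b h), x ^ (2 * j) * √(2 * (h - G₁.eval x)) =
        ∫ x : ℝ, x ^ (2 * j) * √(2 * (h - G₁.eval x)) := by
      rw [intervalIntegral.integral_of_le hle]
      refine MeasureTheory.setIntegral_eq_integral_of_forall_compl_eq_zero fun x hx => ?_
      have hge : h ≤ G₁.eval x := by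
        by_contra! hlt'
        refine hx ⟨?_, ?_⟩
        · by_contra! hxa
          rcases hxa.lt_or_eq with hxa | rfl
          · exact hlt'.not_gt (hla x hxa)
          · exact hlt'.ne hah
        · by_contra! hbx
          exact hlt'.not_gt (hlb x hbx)
      rw [Real.sqrt_eq_zero_of_nonpos (by linarith), mul_zero]
    have hscale := G₁.integral_pow_mul_sqrt_level_scale l j hs
    rw [hsh] at hscale
    rw [G₁.integral_pow_mul_derivative_div_sqrt hle hah hbh hlt (hint h hh) j, hfull, hscale, hsp,
      Function.comp_apply, ← hs_def, hsh]
    field_simp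
end
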